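/- There exists a constant η₁ > 0 depending only on V with the following property: for every x₀ ∈ Ω and r > 0 with D(x₀,r) ⊂ Ω, if ν_⋆(D̄(x₀,r)) < η₁·r then ν_⋆(D̄(x₀, r/2)) = 0. -/

import Mathlib

open MeasureTheory Metric Filter Topology Bornology
open scoped RealInnerProductSpace ENNReal Topology

noncomputable section

/-- The euclidean plane. -/
abbrev E2 : Type := EuclideanSpace ℝ (Fin 2)

/-- The euclidean space `ℝ^k`. -/
abbrev Evec (k : ℕ) : Type := EuclideanSpace ℝ (Fin k)

/-- The `i`-th standard basis vector of the plane. -/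
def b2 (i : Fin 2) : E2 := EuclideanSpace.single i (1 : ℝ)

/-- The partial derivative of `u` in the `i`-th coordinate direction. -/
def pder {k : ℕ} (u : E2 → Evec k) (i : Fin 2) (x : E2) : Evec k :=
  fderiv ℝ u x (b2 i)

/-- The Laplacian of a map defined on the plane. -/
def lap {k : ℕ} (u : E2 → Evec k) (x : E2) : Evec k :=
  ∑ i : Fin 2, fderiv ℝ (pder u i) x (b2 i)

/-- `u` is a smooth solution of the vectorial Allen-Cahn system
`Δu = ε⁻² ∇V(u)` on the open set `U`. -/
def IsSolution {k : ℕ} (V : Evec k → ℝ) (ε : ℝ) (U : Set E2) (u : E2 → Evec k) : Prop :=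
  ContDiffOn ℝ (⊤ : ℕ∞) u U ∧ ∀ x ∈ U, lap u x = (ε ^ 2)⁻¹ • gradient V (u x)

/-- The squared modulus `|∇u|²` of the full gradient. -/
def gradSq {k : ℕ} (u : E2 → Evec k) (x : E2) : ℝ :=
  ∑ i : Fin 2, ‖pder u i x‖ ^ 2

/-- The energy density `e_ε(u) = (ε/2)|∇u|² + ε⁻¹ V(u)`. -/
def eDens {k : ℕ} (V : Evec k → ℝ) (ε : ℝ) (u : E2 → Evec k) (x : E2) : ℝ :=
  ε / 2 * gradSq u x + ε⁻¹ * V (u x)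

/-- The energy `E_ε(u, G)`. -/
def energy {k : ℕ} (V : Evec k → ℝ) (ε : ℝ) (u : E2 → Evec k) (G : Set E2) : ℝ :=
  ∫ x in G, eDens V ε u x

/-- The hypotheses (H₁), (H₂), (H₃) on the multi-well potential `V`:
smooth, nonnegative with `inf V = 0`, finitely many zeros (at least two),
positive definite Hessian at each zero, quadratic growth of `y·∇V(y)` at
infinity and coercivity. -/
structure IsMultiWell {k : ℕ} (V : Evec k → ℝ) : Prop where
  smooth : ContDiff ℝ (⊤ : ℕ∞) V
  nonneg : ∀ y, 0 ≤ V y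
  finite_zeros : {y : Evec k | V y = 0}.Finite
  two_le_card : 2 ≤ {y : Evec k | V y = 0}.ncard
  hess_posdef : ∀ σ : Evec k, V σ = 0 → ∀ w : Evec k, w ≠ 0 →
    0 < iteratedFDeriv ℝ 2 V σ ![w, w]
  growth : ∃ α > (0 : ℝ), ∃ R > (0 : ℝ), ∀ y : Evec k, R < ‖y‖ →
    α * ‖y‖ ^ 2 ≤ ⟪y, gradient V y⟫
  coercive : ∀ C : ℝ, ∃ R : ℝ, ∀ y : Evec k, R ≤ ‖y‖ → C ≤ V y

/-- A continuous test function compactly supported in `Ω`. -/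
def TestFun (Ω : Set E2) (f : E2 → ℝ) : Prop :=
  Continuous f ∧ HasCompactSupport f ∧ tsupport f ⊆ Ω

/-- The lower one-dimensional density of the measure `ν` at `x`. -/
def densLow (ν : Measure E2) (x : E2) : ℝ :=
  Filter.liminf (fun r : ℝ => (ν (closedBall x r)).toReal / r) (𝓝[>] 0)

/-- The concentration set `𝔖⋆ = {x ∈ Ω | liminf_{r→0} ν(D̄(x,r))/r ≥ η}`. -/
def concSet (ν : Measure E2) (Ω : Set E2) (η : ℝ) : Set E2 :=
  {x ∈ Ω | η ≤ densLow ν x}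

section Potential

variable {k : ℕ} {V : Evec k → ℝ}

lemma gradient_eq_toDual_symm (V : Evec k → ℝ) :
    gradient V = fun y => (InnerProductSpace.toDual ℝ (Evec k)).symm (fderiv ℝ V y) := rfl

lemma contDiff_gradient (hV : ContDiff ℝ (⊤ : ℕ∞) V) : ContDiff ℝ (⊤ : ℕ∞) (gradient V) := by
  rw [gradient_eq_toDual_symm]
  exact (InnerProductSpace.toDual ℝ (Evec k)).symm.contDiff.comp
    (hV.fderiv_right (m := (⊤ : ℕ∞)) (by norm_cast))

lemma fderiv_eq_inner_gradient (V : Evec k → ℝ) (y v : Evec k) :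
    fderiv ℝ V y v = ⟪gradient V y, v⟫ := by
  rw [inner_gradient_left]

lemma inner_fderiv_gradient (hV : ContDiff ℝ (⊤ : ℕ∞) V) (y w : Evec k) :
    ⟪fderiv ℝ (gradient V) y w, w⟫ = iteratedFDeriv ℝ 2 V y ![w, w] := by
  have hG : DifferentiableAt ℝ (gradient V) y :=
    (contDiff_gradient hV).differentiable (by simp) y
  have h1 : fderiv ℝ V =
      (InnerProductSpace.toDual ℝ (Evec k)).toContinuousLinearEquiv ∘ gradient V := by
    ext z v
    rw [fderiv_eq_inner_gradient]
    rfl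
  rw [iteratedFDeriv_two_apply, h1, ContinuousLinearEquiv.comp_fderiv]
  simp

lemma exists_quadratic_lower_bound (L : Evec k →L[ℝ] Evec k)
    (hL : ∀ w, w ≠ 0 → 0 < ⟪L w, w⟫) :
    ∃ m > (0 : ℝ), ∀ w, m * ‖w‖ ^ 2 ≤ ⟪L w, w⟫ := by
  have hc : ContinuousOn (fun w : Evec k => ⟪L w, w⟫) (sphere 0 1) := by fun_prop
  obtain ⟨m, hm, hmin⟩ := (isCompact_sphere (0 : Evec k) 1).exists_forall_le' hc
    (a := 0) (fun w hw => hL w (by rintro rfl; simp at hw))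
  refine ⟨m, hm, fun w => ?_⟩
  by_cases hw : w = 0
  · simp [hw]
  have hn : 0 < ‖w‖ := norm_pos_iff.2 hw
  have h := hmin (‖w‖⁻¹ • w) (by simp [norm_smul, hn.ne'])
  simp only [map_smul, inner_smul_left, inner_smul_right, RCLike.conj_to_real] at h
  have h2 : ‖w‖ ^ 2 * m ≤ ‖w‖ ^ 2 * (‖w‖⁻¹ * (‖w‖⁻¹ * ⟪L w, w⟫)) := by gcongr
  have h3 : ‖w‖ ^ 2 * (‖w‖⁻¹ * (‖w‖⁻¹ * ⟪L w, w⟫)) = ⟪L w, w⟫ := by field_simp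
  linarith

lemma IsMultiWell.gradient_eq_zero (hV : IsMultiWell V) {σ : Evec k} (hσ : V σ = 0) :
    gradient V σ = 0 := by
  have h : IsLocalMin V σ := Filter.Eventually.of_forall fun y => by rw [hσ]; exact hV.nonneg y
  rw [gradient_eq_toDual_symm]
  simp [h.fderiv_eq_zero]

lemma IsMultiWell.exists_gradient_bounds (hV : IsMultiWell V) {σ : Evec k} (hσ : V σ = 0) :
    ∃ a > (0 : ℝ), ∀ y, ‖y - σ‖ ≤ a →
      a * ‖y - σ‖ ^ 2 ≤ ⟪gradient V y, y - σ⟫ ∧ ‖gradient V y‖ ≤ ‖y - σ‖ / a := by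
  set L := fderiv ℝ (gradient V) σ with hLdef
  obtain ⟨m, hm, hmL⟩ := exists_quadratic_lower_bound L (fun w hw => by
    rw [hLdef, inner_fderiv_gradient hV.smooth]; exact hV.hess_posdef σ hσ w hw)
  have hd : HasFDerivAt (gradient V) L σ :=
    ((contDiff_gradient hV.smooth).differentiable (by simp) σ).hasFDerivAt
  have ho := hd.isLittleO.bound (half_pos hm)
  obtain ⟨r, hr, hball⟩ := Metric.eventually_nhds_iff.1 ho
  have hLn : 0 ≤ ‖L‖ := norm_nonneg L
  set a := min (r / 2) (min (m / 2) (1 / (‖L‖ + m))) with ha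
  have ha0 : 0 < a := by positivity
  have ha1 : a ≤ r / 2 := min_le_left _ _
  have ha2 : a ≤ m / 2 := (min_le_right _ _).trans (min_le_left _ _)
  have ha3 : a ≤ 1 / (‖L‖ + m) := (min_le_right _ _).trans (min_le_right _ _)
  refine ⟨a, ha0, fun y hy => ?_⟩
  have hb : ‖gradient V y - L (y - σ)‖ ≤ m / 2 * ‖y - σ‖ := by
    have := hball (y := y) (by rw [dist_eq_norm]; linarith)
    simpa [hV.gradient_eq_zero hσ] using this
  constructor
  · have h1 : ⟪gradient V y, y - σ⟫ = ⟪L (y - σ), y - σ⟫ +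
        ⟪gradient V y - L (y - σ), y - σ⟫ := by rw [inner_sub_left]; ring
    have h2 := abs_le.1 (abs_real_inner_le_norm (gradient V y - L (y - σ)) (y - σ))
    have h3 : ‖gradient V y - L (y - σ)‖ * ‖y - σ‖ ≤ m / 2 * ‖y - σ‖ * ‖y - σ‖ := by gcongr
    have h4 := hmL (y - σ)
    nlinarith [h2.1, sq_nonneg ‖y - σ‖]
  · have h1 : ‖gradient V y‖ ≤ ‖L (y - σ)‖ + ‖gradient V y - L (y - σ)‖ := by
      have := norm_add_le (L (y - σ)) (gradient V y - L (y - σ))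
      simpa using this
    have h2 := L.le_opNorm (y - σ)
    have h3 : ‖gradient V y‖ ≤ (‖L‖ + m) * ‖y - σ‖ := by
      nlinarith [norm_nonneg (y - σ)]
    rw [le_div_iff₀ ha0]
    have h4 : (‖L‖ + m) * a ≤ 1 := by
      rw [le_div_iff₀ (by positivity)] at ha3; linarith
    nlinarith [norm_nonneg (y - σ)]

lemma IsMultiWell.le_and_le_of_gradient_bounds (hV : IsMultiWell V) {σ : Evec k} (hσ : V σ = 0)
    {a : ℝ} (ha : 0 < a) (h : ∀ y, ‖y - σ‖ ≤ a →
      a * ‖y - σ‖ ^ 2 ≤ ⟪gradient V y, y - σ⟫ ∧ ‖gradient V y‖ ≤ ‖y - σ‖ / a)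
    {y : Evec k} (hy : ‖y - σ‖ ≤ a) :
    a / 2 * ‖y - σ‖ ^ 2 ≤ V y ∧ V y ≤ ‖y - σ‖ ^ 2 / a := by
  set w := y - σ with hw
  have hVd : Differentiable ℝ V := hV.smooth.differentiable (by simp)
  have hd : ∀ t : ℝ, HasDerivAt (fun t : ℝ => V (σ + t • w)) ⟪gradient V (σ + t • w), w⟫ t := by
    intro t
    have h1 : HasDerivAt (fun t : ℝ => σ + t • w) w t := by
      simpa using ((hasDerivAt_id t).smul_const w).const_add σ
    have h2 := (hVd (σ + t • w)).hasFDerivAt.comp_hasDerivAt t h1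
    rw [fderiv_eq_inner_gradient] at h2
    exact h2
  have hmem : ∀ t ∈ Set.Ioo (0 : ℝ) 1, a * t * ‖w‖ ^ 2 ≤ ⟪gradient V (σ + t • w), w⟫ ∧
      ⟪gradient V (σ + t • w), w⟫ ≤ 2 * t * ‖w‖ ^ 2 / a := by
    intro t ht
    have hn : ‖σ + t • w - σ‖ = t * ‖w‖ := by
      rw [add_sub_cancel_left, norm_smul, Real.norm_of_nonneg ht.1.le]
    have hle : ‖σ + t • w - σ‖ ≤ a := by
      rw [hn]; nlinarith [ht.1, ht.2, norm_nonneg w]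
    obtain ⟨h1, h2⟩ := h _ hle
    rw [hn] at h1 h2
    rw [add_sub_cancel_left, inner_smul_right] at h1
    constructor
    · refine le_of_mul_le_mul_left ?_ ht.1
      linarith
    · have h3 := real_inner_le_norm (gradient V (σ + t • w)) w
      have h4 : ‖gradient V (σ + t • w)‖ * ‖w‖ ≤ t * ‖w‖ / a * ‖w‖ := by gcongr
      have h5 : t * ‖w‖ / a * ‖w‖ = t * ‖w‖ ^ 2 / a := by ring
      have h6 : 0 ≤ t * ‖w‖ ^ 2 / a := by have := ht.1; positivity
      have h7 : 2 * t * ‖w‖ ^ 2 / a = 2 * (t * ‖w‖ ^ 2 / a) := by ring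
      linarith
  have hy1 : V (σ + (1 : ℝ) • w) = V y := by simp [hw]
  have hy0 : V (σ + (0 : ℝ) • w) = 0 := by simp [hσ]
  have hdq : ∀ c t : ℝ, HasDerivAt (fun t : ℝ => c * t ^ 2) (2 * c * t) t := by
    intro c t
    have := ((hasDerivAt_id t).pow 2).const_mul c
    exact this.congr_deriv (by simp; ring)
  constructor
  · have hmono : MonotoneOn (fun t : ℝ => V (σ + t • w) - a / 2 * ‖w‖ ^ 2 * t ^ 2)
        (Set.Icc 0 1) := by
      refine monotoneOn_of_deriv_nonneg (convex_Icc 0 1) ?_ ?_ ?_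
      · exact fun t _ => ((hd t).sub (hdq _ t)).continuousAt.continuousWithinAt
      · exact fun t _ => ((hd t).sub (hdq _ t)).differentiableAt.differentiableWithinAt
      · intro t ht
        rw [interior_Icc] at ht
        have := ((hd t).sub (hdq (a / 2 * ‖w‖ ^ 2) t)).deriv
        have h3 := (hmem t ht).1
        change 0 ≤ deriv ((fun t : ℝ => V (σ + t • w)) - fun t => a / 2 * ‖w‖ ^ 2 * t ^ 2) t
        rw [this]; linarith
    have := hmono (by simp) (by simp) zero_le_one
    simp only [hy1, hy0] at this
    linarith
  · have hmono : MonotoneOn (fun t : ℝ => ‖w‖ ^ 2 / a * t ^ 2 - V (σ + t • w))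
        (Set.Icc 0 1) := by
      refine monotoneOn_of_deriv_nonneg (convex_Icc 0 1) ?_ ?_ ?_
      · exact fun t _ => ((hdq _ t).sub (hd t)).continuousAt.continuousWithinAt
      · exact fun t _ => ((hdq _ t).sub (hd t)).differentiableAt.differentiableWithinAt
      · intro t ht
        rw [interior_Icc] at ht
        have := ((hdq (‖w‖ ^ 2 / a) t).sub (hd t)).deriv
        have h3 := (hmem t ht).2
        change 0 ≤ deriv ((fun t : ℝ => ‖w‖ ^ 2 / a * t ^ 2) - fun t => V (σ + t • w)) t
        rw [this]
        have : 2 * (‖w‖ ^ 2 / a) * t = 2 * t * ‖w‖ ^ 2 / a := by ring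
        linarith
    have := hmono (by simp) (by simp) zero_le_one
    simp only [hy1, hy0] at this
    linarith

/-- Quadratic behaviour of the potential near all its wells, with a single constant. -/
lemma IsMultiWell.exists_well_bounds (hV : IsMultiWell V) :
    ∃ a : ℝ, 0 < a ∧ a < 1 ∧ ∀ σ, V σ = 0 → ∀ y, ‖y - σ‖ ≤ a →
      a * ‖y - σ‖ ^ 2 ≤ ⟪gradient V y, y - σ⟫ ∧ ‖gradient V y‖ ≤ ‖y - σ‖ / a ∧
      a * ‖y - σ‖ ^ 2 ≤ V y ∧ V y ≤ ‖y - σ‖ ^ 2 / a := by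
  have key : ∀ σ ∈ {y : Evec k | V y = 0}, ∀ᶠ a in 𝓝[>] (0 : ℝ), ∀ y, ‖y - σ‖ ≤ a →
      a * ‖y - σ‖ ^ 2 ≤ ⟪gradient V y, y - σ⟫ ∧ ‖gradient V y‖ ≤ ‖y - σ‖ / a ∧
      a * ‖y - σ‖ ^ 2 ≤ V y ∧ V y ≤ ‖y - σ‖ ^ 2 / a := by
    intro σ hσ
    obtain ⟨b, hb, hbb⟩ := hV.exists_gradient_bounds hσ
    have : Set.Ioo (0 : ℝ) (b / 2) ∈ 𝓝[>] (0 : ℝ) := Ioo_mem_nhdsGT (half_pos hb)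
    filter_upwards [this] with a ha y hy
    have ha0 : 0 < a := ha.1
    have hab : a ≤ b / 2 := ha.2.le
    obtain ⟨h1, h2⟩ := hbb y (by linarith)
    obtain ⟨h3, h4⟩ := hV.le_and_le_of_gradient_bounds hσ hb hbb (y := y) (by linarith)
    have hn : 0 ≤ ‖y - σ‖ := norm_nonneg _
    refine ⟨le_trans ?_ h1, h2.trans ?_, le_trans ?_ h3, h4.trans ?_⟩
    · gcongr; linarith
    · gcongr; linarith
    · gcongr
    · gcongr; linarith
  have h1 : ∀ᶠ a in 𝓝[>] (0 : ℝ), a < 1 :=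
    mem_nhdsWithin_of_mem_nhds (Iio_mem_nhds one_pos)
  obtain ⟨a, ha, ha1, hapos⟩ :=
    (((hV.finite_zeros.eventually_all).2 key).and (h1.and self_mem_nhdsWithin)).exists
  exact ⟨a, hapos, ha1, ha⟩

lemma IsMultiWell.exists_near_well (hV : IsMultiWell V) {κ : ℝ} (hκ : 0 < κ) :
    ∃ δ : ℝ, 0 < δ ∧ δ < 1 ∧ ∀ y, V y ≤ δ → ∃ σ, V σ = 0 ∧ ‖y - σ‖ < κ := by
  obtain ⟨R, hR⟩ := hV.coercive 1
  set K : Set (Evec k) := closedBall 0 R ∩ (⋃ σ ∈ {y : Evec k | V y = 0}, ball σ κ)ᶜ with hK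
  have hKc : IsCompact K := (isCompact_closedBall 0 R).inter_right
    (isOpen_biUnion fun _ _ => isOpen_ball).isClosed_compl
  obtain ⟨m, hm, hmin⟩ := hKc.exists_forall_le' (hV.smooth.continuous.continuousOn) (a := 0)
    (fun y hy => lt_of_le_of_ne (hV.nonneg y) fun h => hy.2
      (Set.mem_biUnion (x := y) h.symm (mem_ball_self hκ)))
  refine ⟨min (1 / 2) (m / 2), by positivity, ?_, fun y hy => ?_⟩
  · exact (min_le_left _ _).trans_lt (by norm_num)
  · have hy1 : V y ≤ 1 / 2 := hy.trans (min_le_left _ _)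
    have hy2 : V y ≤ m / 2 := hy.trans (min_le_right _ _)
    by_contra hcon
    push Not at hcon
    have hyR : ‖y‖ ≤ R := by
      by_contra h
      have := hR y (not_le.1 h).le
      linarith
    have : y ∈ K := by
      refine ⟨by simpa using hyR, ?_⟩
      simp only [Set.mem_compl_iff, Set.mem_iUnion, not_exists, mem_ball, dist_eq_norm, not_lt]
      exact fun σ hσ => hcon σ hσ
    have := hmin y this
    linarith

lemma IsMultiWell.exists_sublevel_bound (hV : IsMultiWell V) :
    ∃ R > (0 : ℝ), ∀ y, V y ≤ 1 → ‖y‖ ≤ R := by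
  obtain ⟨R, hR⟩ := hV.coercive 2
  refine ⟨max R 1, by positivity, fun y hy => ?_⟩
  by_contra h
  have := hR y ((le_max_left _ _).trans (not_le.1 h).le)
  linarith

lemma IsMultiWell.exists_gradient_sq_le (hV : IsMultiWell V) :
    ∃ C > (0 : ℝ), ∀ y, V y ≤ 1 → ‖gradient V y‖ ^ 2 ≤ C ^ 2 * V y := by
  obtain ⟨a, ha, -, hab⟩ := hV.exists_well_bounds
  obtain ⟨δ, hδ, -, hδb⟩ := hV.exists_near_well ha
  obtain ⟨R, hR, hRb⟩ := hV.exists_sublevel_bound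
  obtain ⟨M, hM⟩ := (isCompact_closedBall (0 : Evec k) R).exists_bound_of_continuousOn
    (contDiff_gradient hV.smooth).continuous.continuousOn
  set D := 1 + 1 / a ^ 3 + M ^ 2 / δ with hD
  have hD1 : 1 ≤ D := by
    have : 0 ≤ 1 / a ^ 3 + M ^ 2 / δ := by positivity
    linarith
  refine ⟨D, by linarith, fun y hy => ?_⟩
  have hDD : D ≤ D ^ 2 := by nlinarith
  have hVy := hV.nonneg y
  suffices h : ‖gradient V y‖ ^ 2 ≤ D * V y by nlinarith
  have e1 : 0 ≤ 1 / a ^ 3 := by positivity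
  have e2 : 0 ≤ M ^ 2 / δ := by positivity
  by_cases h : V y ≤ δ
  · obtain ⟨σ, hσ, hyσ⟩ := hδb y h
    obtain ⟨-, h2, h3, -⟩ := hab σ hσ y hyσ.le
    have : ‖gradient V y‖ ^ 2 ≤ (‖y - σ‖ / a) ^ 2 := by gcongr
    have h5 : (‖y - σ‖ / a) ^ 2 = 1 / a ^ 3 * (a * ‖y - σ‖ ^ 2) := by field_simp
    have h6 : 1 / a ^ 3 * (a * ‖y - σ‖ ^ 2) ≤ 1 / a ^ 3 * V y := by gcongr
    nlinarith
  · have h1 := hM y (by simpa using hRb y hy)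
    have h2 : ‖gradient V y‖ ^ 2 ≤ M ^ 2 := by gcongr
    have h3 : M ^ 2 = M ^ 2 / δ * δ := by field_simp
    have h4 : M ^ 2 / δ * δ ≤ M ^ 2 / δ * V y := by gcongr; exact (not_le.1 h).le
    nlinarith

lemma IsMultiWell.exists_bounds_on_ball (hV : IsMultiWell V) (R : ℝ) :
    ∃ K > (0 : ℝ), ∀ y, ‖y‖ ≤ R → ‖gradient V y‖ ≤ K ∧
      ∀ v, -(K * ‖v‖ ^ 2) ≤ ⟪fderiv ℝ (gradient V) y v, v⟫ := by
  have hG := contDiff_gradient hV.smooth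
  obtain ⟨M, hM⟩ := (isCompact_closedBall (0 : Evec k) R).exists_bound_of_continuousOn
    hG.continuous.continuousOn
  obtain ⟨N, hN⟩ := (isCompact_closedBall (0 : Evec k) R).exists_bound_of_continuousOn
    (hG.continuous_fderiv (by simp)).continuousOn
  refine ⟨max 1 (max M N), by positivity, fun y hy => ?_⟩
  have hy' : y ∈ closedBall (0 : Evec k) R := by simpa using hy
  refine ⟨(hM y hy').trans ((le_max_left _ _).trans (le_max_right _ _)), fun v => ?_⟩
  have h1 := abs_le.1 (abs_real_inner_le_norm (fderiv ℝ (gradient V) y v) v)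
  have h2 : ‖fderiv ℝ (gradient V) y v‖ * ‖v‖ ≤ max 1 (max M N) * ‖v‖ * ‖v‖ := by
    gcongr
    refine ((fderiv ℝ (gradient V) y).le_opNorm v).trans ?_
    gcongr
    exact (hN y hy').trans ((le_max_right _ _).trans (le_max_right _ _))
  nlinarith [h1.1]

end Potential

section Calculus

variable {k : ℕ} {V : Evec k → ℝ} {u : E2 → Evec k} {ε : ℝ}

lemma b2_apply (i j : Fin 2) : b2 i j = if j = i then 1 else 0 := by
  simp [b2]

lemma norm_b2 (i : Fin 2) : ‖b2 i‖ = 1 := by simp [b2]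

lemma hasDerivAt_line {E F : Type*} [NormedAddCommGroup E] [NormedSpace ℝ E]
    [NormedAddCommGroup F] [NormedSpace ℝ F] {f : E → F} (hf : Differentiable ℝ f)
    (x v : E) (t : ℝ) :
    HasDerivAt (fun t : ℝ => f (x + t • v)) (fderiv ℝ f (x + t • v) v) t := by
  have h1 : HasDerivAt (fun t : ℝ => x + t • v) v t := by
    simpa using ((hasDerivAt_id t).smul_const v).const_add x
  exact (hf (x + t • v)).hasFDerivAt.comp_hasDerivAt t h1

/-- A directional derivative can be computed along a line. -/
lemma fderiv_apply_eq_of_hasDerivAt_line {E F : Type*} [NormedAddCommGroup E] [NormedSpace ℝ E]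
    [NormedAddCommGroup F] [NormedSpace ℝ F] {f : E → F} (hf : Differentiable ℝ f)
    {x v : E} {c : F} (h : HasDerivAt (fun t : ℝ => f (x + t • v)) c 0) :
    fderiv ℝ f x v = c := by
  have := hasDerivAt_line hf x v 0
  rw [zero_smul, add_zero] at this
  exact this.unique h

lemma contDiff_pder (hu : ContDiff ℝ (⊤ : ℕ∞) u) (i : Fin 2) :
    ContDiff ℝ (⊤ : ℕ∞) (pder u i) :=
  (hu.fderiv_right (m := (⊤ : ℕ∞)) (by norm_cast)).clm_apply contDiff_const

lemma fderiv_pder_comm (hu : ContDiff ℝ (⊤ : ℕ∞) u) (i j : Fin 2) (x : E2) :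
    fderiv ℝ (pder u i) x (b2 j) = fderiv ℝ (pder u j) x (b2 i) := by
  have hd : DifferentiableAt ℝ (fderiv ℝ u) x :=
    (hu.fderiv_right (m := (⊤ : ℕ∞)) (by norm_cast)).differentiable (by simp) x
  have h : ∀ a b : Fin 2, fderiv ℝ (pder u a) x (b2 b) =
      fderiv ℝ (fderiv ℝ u) x (b2 b) (b2 a) := by
    intro a b
    have h1 := (hd.hasFDerivAt.clm_apply (hasFDerivAt_const (b2 a) x)).fderiv
    change fderiv ℝ (fun y => fderiv ℝ u y (b2 a)) x (b2 b) = _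
    rw [h1]; simp
  rw [h, h]
  exact hu.contDiffAt.isSymmSndFDerivAt
    (by simpa using (WithTop.coe_le_coe.2 (le_top : (2 : ℕ∞) ≤ ⊤))) (b2 j) (b2 i)

lemma continuous_gradSq (hu : ContDiff ℝ (⊤ : ℕ∞) u) : Continuous (gradSq u) := by
  have := fun i => (contDiff_pder hu i).continuous
  unfold gradSq
  fun_prop

lemma gradSq_nonneg (u : E2 → Evec k) (x : E2) : 0 ≤ gradSq u x :=
  Finset.sum_nonneg fun _ _ => by positivity

lemma contDiff_eDens (hV : ContDiff ℝ (⊤ : ℕ∞) V) (hu : ContDiff ℝ (⊤ : ℕ∞) u) (ε : ℝ) :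
    ContDiff ℝ (⊤ : ℕ∞) (eDens V ε u) := by
  have h := fun i => contDiff_pder hu i
  unfold eDens gradSq
  refine (contDiff_const.mul (ContDiff.sum fun i _ => (h i).norm_sq ℝ)).add
    (contDiff_const.mul (hV.comp hu))

lemma continuous_eDens (hV : ContDiff ℝ (⊤ : ℕ∞) V) (hu : ContDiff ℝ (⊤ : ℕ∞) u) (ε : ℝ) :
    Continuous (eDens V ε u) := (contDiff_eDens hV hu ε).continuous

lemma eDens_nonneg (hV : ∀ y, 0 ≤ V y) (hε : 0 < ε) (u : E2 → Evec k) (x : E2) :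
    0 ≤ eDens V ε u x := by
  have := gradSq_nonneg u x
  have := hV (u x)
  unfold eDens
  positivity

lemma integral_mul_fderiv_eq_neg {φ g : E2 → ℝ} (hφ : ContDiff ℝ 1 φ) (hc : HasCompactSupport φ)
    (hg : ContDiff ℝ 1 g) (v : E2) :
    ∫ x, φ x * fderiv ℝ g x v = -∫ x, fderiv ℝ φ x v * g x := by
  have hφ' : Continuous fun x => fderiv ℝ φ x v :=
    (hφ.continuous_fderiv (by simp)).clm_apply continuous_const
  have hg' : Continuous fun x => fderiv ℝ g x v :=
    (hg.continuous_fderiv (by simp)).clm_apply continuous_const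
  refine integral_mul_fderiv_eq_neg_fderiv_mul_of_integrable ?_ ?_ ?_
    (fun x _ => hφ.differentiable (by simp) x) (fun x _ => hg.differentiable (by simp) x)
  · refine (hφ'.mul hg.continuous).integrable_of_hasCompactSupport ?_
    exact HasCompactSupport.mul_right (hc.fderiv_apply (𝕜 := ℝ) v)
  · exact (hφ.continuous.mul hg').integrable_of_hasCompactSupport hc.mul_right
  · exact (hφ.continuous.mul hg.continuous).integrable_of_hasCompactSupport hc.mul_right

/-- Summed integration by parts for a pair of `C¹` functions. -/
lemma integral_mul_div_eq_neg {φ : E2 → ℝ} {g : Fin 2 → E2 → ℝ} (hφ : ContDiff ℝ 1 φ)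
    (hc : HasCompactSupport φ) (hg : ∀ i, ContDiff ℝ 1 (g i)) :
    ∫ x, φ x * ∑ i, fderiv ℝ (g i) x (b2 i) =
      -∫ x, ∑ i, fderiv ℝ φ x (b2 i) * g i x := by
  have hφ' : ∀ v, Continuous fun x => fderiv ℝ φ x v := fun v =>
    (hφ.continuous_fderiv (by simp)).clm_apply continuous_const
  have hg' : ∀ i v, Continuous fun x => fderiv ℝ (g i) x v := fun i v =>
    ((hg i).continuous_fderiv (by simp)).clm_apply continuous_const
  simp_rw [Finset.mul_sum]
  rw [integral_finsetSum, integral_finsetSum, ← Finset.sum_neg_distrib]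
  · exact Finset.sum_congr rfl fun i _ => integral_mul_fderiv_eq_neg hφ hc (hg i) _
  · intro i _
    refine ((hφ' _).mul (hg i).continuous).integrable_of_hasCompactSupport ?_
    exact HasCompactSupport.mul_right (hc.fderiv_apply (𝕜 := ℝ) _)
  · intro i _
    exact (hφ.continuous.mul (hg' i _)).integrable_of_hasCompactSupport hc.mul_right

/-- The system tested against `φ G(|u - σ|²) (u - σ)`. -/
lemma integral_test_radial (hu : ContDiff ℝ (⊤ : ℕ∞) u) {φ : E2 → ℝ} (hφ : ContDiff ℝ 1 φ)
    (hc : HasCompactSupport φ)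
    (hsol : ∀ x, φ x ≠ 0 → lap u x = (ε ^ 2)⁻¹ • gradient V (u x))
    {G G' : ℝ → ℝ} (hG : ContDiff ℝ 1 fun y : Evec k => G (‖y‖ ^ 2))
    (hG' : ∀ s, 0 ≤ s → HasDerivAt G (G' s) s) (σ : Evec k) :
    ∫ x, φ x * (G (‖u x - σ‖ ^ 2) * ((ε ^ 2)⁻¹ * ⟪gradient V (u x), u x - σ⟫) +
      ∑ i, (G (‖u x - σ‖ ^ 2) * ‖pder u i x‖ ^ 2 +
        2 * G' (‖u x - σ‖ ^ 2) * ⟪pder u i x, u x - σ⟫ ^ 2)) =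
    -∫ x, ∑ i, fderiv ℝ φ x (b2 i) * (G (‖u x - σ‖ ^ 2) * ⟪pder u i x, u x - σ⟫) := by
  have hw : ContDiff ℝ (⊤ : ℕ∞) fun x => u x - σ := hu.sub contDiff_const
  have hg : ∀ i, ContDiff ℝ 1 fun x => G (‖u x - σ‖ ^ 2) * ⟪pder u i x, u x - σ⟫ := by
    intro i
    refine (hG.comp (hw.of_le (by simp))).mul ?_
    exact (((contDiff_pder hu i).of_le (by simp)).inner ℝ (hw.of_le (by simp)))
  rw [← integral_mul_div_eq_neg hφ hc hg]
  refine integral_congr_ae (Filter.Eventually.of_forall fun x => ?_)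
  by_cases hx : φ x = 0
  · simp [hx]
  have hfd : ∀ i, fderiv ℝ (fun x => G (‖u x - σ‖ ^ 2) * ⟪pder u i x, u x - σ⟫) x (b2 i) =
      G (‖u x - σ‖ ^ 2) * ⟪fderiv ℝ (pder u i) x (b2 i), u x - σ⟫ +
      (G (‖u x - σ‖ ^ 2) * ‖pder u i x‖ ^ 2 +
        2 * G' (‖u x - σ‖ ^ 2) * ⟪pder u i x, u x - σ⟫ ^ 2) := by
    intro i
    refine fderiv_apply_eq_of_hasDerivAt_line ((hg i).differentiable (by simp)) ?_
    have h1 : HasDerivAt (fun t : ℝ => u (x + t • b2 i) - σ) (pder u i x) 0 := by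
      have := (hasDerivAt_line (hu.differentiable (by simp)) x (b2 i) 0).sub_const σ
      simpa [pder] using this
    have h2 : HasDerivAt (fun t : ℝ => pder u i (x + t • b2 i))
        (fderiv ℝ (pder u i) x (b2 i)) 0 := by
      have := hasDerivAt_line ((contDiff_pder hu i).differentiable (by simp)) x (b2 i) 0
      simpa using this
    have h3 := h1.norm_sq
    simp only [zero_smul, add_zero] at h3
    have h4 : HasDerivAt G (G' (‖u x - σ‖ ^ 2)) (‖u (x + (0 : ℝ) • b2 i) - σ‖ ^ 2) := by
      simpa using hG' (‖u x - σ‖ ^ 2) (by positivity)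
    have h5 := h4.comp (0 : ℝ) h3
    have h6 := h5.mul (h2.inner ℝ h1)
    refine h6.congr_deriv ?_
    simp only [Function.comp, zero_smul, add_zero, real_inner_self_eq_norm_sq]
    rw [real_inner_comm (u x - σ) (pder u i x)]
    ring
  simp only [hfd, Finset.sum_add_distrib]
  have hl : ∑ i, G (‖u x - σ‖ ^ 2) * ⟪fderiv ℝ (pder u i) x (b2 i), u x - σ⟫ =
      G (‖u x - σ‖ ^ 2) * ((ε ^ 2)⁻¹ * ⟪gradient V (u x), u x - σ⟫) := by
    rw [← Finset.mul_sum, ← sum_inner]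
    have : ∑ i, fderiv ℝ (pder u i) x (b2 i) = lap u x := rfl
    rw [this, hsol x hx, real_inner_smul_left]
  rw [hl]

/-- The stress-energy tensor applied to the position field. -/
def stressField (V : Evec k → ℝ) (ε : ℝ) (u : E2 → Evec k) (i : Fin 2) (x : E2) : ℝ :=
  x i * eDens V ε u x - ε * ∑ j, x j * ⟪pder u i x, pder u j x⟫

lemma fderiv_stressField_sum (hV : ContDiff ℝ (⊤ : ℕ∞) V) (hu : ContDiff ℝ (⊤ : ℕ∞) u)
    (hε : ε ≠ 0) {x : E2} (hsol : lap u x = (ε ^ 2)⁻¹ • gradient V (u x)) :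
    (∀ i, ContDiff ℝ 1 (stressField V ε u i)) ∧
    ∑ i, fderiv ℝ (stressField V ε u i) x (b2 i) = 2 * (ε⁻¹ * V (u x)) := by
  have hp := fun i => contDiff_pder hu i
  have hx : ∀ i : Fin 2, ContDiff ℝ 1 fun x : E2 => x i := by
    intro i; fun_prop
  have hC : ∀ i, ContDiff ℝ 1 (stressField V ε u i) := by
    intro i
    refine ((hx i).mul ((contDiff_eDens hV hu ε).of_le (by simp))).sub
      (contDiff_const.mul (ContDiff.sum fun j _ => (hx j).mul ?_))
    exact ((hp i).of_le (by simp)).inner ℝ ((hp j).of_le (by simp))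
  refine ⟨hC, ?_⟩
  have hxd : ∀ i j : Fin 2, HasDerivAt (fun t : ℝ => (x + t • b2 i) j)
      (if j = i then 1 else 0) 0 := by
    intro i j
    have : HasDerivAt (fun t : ℝ => x j + t * (if j = i then 1 else 0))
      (if j = i then 1 else 0) 0 := by
      have := ((hasDerivAt_id (0 : ℝ)).mul_const (if j = i then (1 : ℝ) else 0)).const_add (x j)
      exact this.congr_deriv (one_mul _)
    refine this.congr_of_eventuallyEq (Filter.Eventually.of_forall fun t => ?_)
    simp [b2_apply]
  have hpd : ∀ i j : Fin 2, HasDerivAt (fun t : ℝ => pder u j (x + t • b2 i))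
      (fderiv ℝ (pder u j) x (b2 i)) 0 := by
    intro i j
    have := hasDerivAt_line ((hp j).differentiable (by simp)) x (b2 i) 0
    simpa using this
  have hVd : ∀ i, HasDerivAt (fun t : ℝ => V (u (x + t • b2 i)))
      ⟪gradient V (u x), pder u i x⟫ 0 := by
    intro i
    have := hasDerivAt_line ((hV.comp hu).differentiable (by simp)) x (b2 i) 0
    simp only [zero_smul, add_zero] at this
    refine this.congr_deriv ?_
    rw [fderiv_comp x (hV.differentiable (by simp) _) (hu.differentiable (by simp) _)]
    simp [fderiv_eq_inner_gradient, pder, -inner_gradient_left]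
  have hed : ∀ i, HasDerivAt (fun t : ℝ => eDens V ε u (x + t • b2 i))
      (ε / 2 * ∑ j, 2 * ⟪pder u j x, fderiv ℝ (pder u j) x (b2 i)⟫ +
        ε⁻¹ * ⟪gradient V (u x), pder u i x⟫) 0 := by
    intro i
    have h1 : HasDerivAt (fun t : ℝ => gradSq u (x + t • b2 i))
        (∑ j, 2 * ⟪pder u j x, fderiv ℝ (pder u j) x (b2 i)⟫) 0 := by
      have := HasDerivAt.fun_sum (u := Finset.univ) fun j _ => (hpd i j).norm_sq
      simpa [gradSq] using this
    exact (h1.const_mul _).add ((hVd i).const_mul _)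
  have hfd : ∀ i, fderiv ℝ (stressField V ε u i) x (b2 i) =
      eDens V ε u x + x i * (ε / 2 * ∑ j, 2 * ⟪pder u j x, fderiv ℝ (pder u j) x (b2 i)⟫ +
        ε⁻¹ * ⟪gradient V (u x), pder u i x⟫) -
      ε * ∑ j, ((if j = i then 1 else 0) * ⟪pder u i x, pder u j x⟫ +
        x j * (⟪pder u i x, fderiv ℝ (pder u j) x (b2 i)⟫ +
          ⟪fderiv ℝ (pder u i) x (b2 i), pder u j x⟫)) := by
    intro i
    refine fderiv_apply_eq_of_hasDerivAt_line ((hC i).differentiable (by simp)) ?_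
    have h1 := HasDerivAt.fun_sum (u := Finset.univ) fun j _ =>
      (hxd i j).mul ((hpd i i).inner ℝ (hpd i j))
    have h2 := ((hxd i i).mul (hed i)).sub (h1.const_mul ε)
    refine h2.congr_deriv ?_
    simp
  have hsol' : fderiv ℝ (pder u 0) x (b2 0) + fderiv ℝ (pder u 1) x (b2 1) =
      (ε ^ 2)⁻¹ • gradient V (u x) := by
    rw [← hsol, lap, Fin.sum_univ_two]
  have hg : gradient V (u x) = ε ^ 2 •
      (fderiv ℝ (pder u 0) x (b2 0) + fderiv ℝ (pder u 1) x (b2 1)) := by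
    rw [hsol', smul_smul, mul_inv_cancel₀ (pow_ne_zero 2 hε), one_smul]
  simp only [hfd, hg, Fin.sum_univ_two, eDens, gradSq, fderiv_pder_comm hu 1 0 x,
    real_inner_smul_left, inner_add_left, real_inner_self_eq_norm_sq]
  rw [real_inner_comm (fderiv ℝ (pder u 0) x (b2 0)) (pder u 0 x),
    real_inner_comm (fderiv ℝ (pder u 0) x (b2 1)) (pder u 0 x),
    real_inner_comm (fderiv ℝ (pder u 0) x (b2 1)) (pder u 1 x),
    real_inner_comm (fderiv ℝ (pder u 1) x (b2 1)) (pder u 1 x)]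
  simp
  field_simp
  ring

/-- Pohozaev's identity, localized by a cut-off function. -/
lemma integral_pohozaev (hV : ContDiff ℝ (⊤ : ℕ∞) V) (hu : ContDiff ℝ (⊤ : ℕ∞) u)
    (hε : ε ≠ 0) {φ : E2 → ℝ} (hφ : ContDiff ℝ 1 φ) (hc : HasCompactSupport φ)
    (hφx : ∃ x, φ x ≠ 0)
    (hsol : ∀ x, φ x ≠ 0 → lap u x = (ε ^ 2)⁻¹ • gradient V (u x)) :
    ∫ x, φ x * (2 * (ε⁻¹ * V (u x))) =
      -∫ x, ∑ i, fderiv ℝ φ x (b2 i) * stressField V ε u i x := by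
  obtain ⟨x₀, hx₀⟩ := hφx
  rw [← integral_mul_div_eq_neg hφ hc (fderiv_stressField_sum hV hu hε (hsol x₀ hx₀)).1]
  refine integral_congr_ae (Filter.Eventually.of_forall fun x => ?_)
  by_cases hx : φ x = 0
  · simp [hx]
  · simp only [(fderiv_stressField_sum hV hu hε (hsol x hx)).2]

lemma abs_stressField_le (hV : ∀ y, 0 ≤ V y) (hε : 0 < ε) (i : Fin 2) {x : E2}
    (hx : ∀ i, |x i| ≤ 1) : |stressField V ε u i x| ≤ 4 * eDens V ε u x := by
  have hV' := hV (u x)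
  have he : ε / 2 * gradSq u x ≤ eDens V ε u x := by
    have : 0 ≤ ε⁻¹ * V (u x) := by positivity
    unfold eDens; linarith
  have he0 := eDens_nonneg hV hε u x
  have hj : ∀ j, |x j * ⟪pder u i x, pder u j x⟫| ≤ 
      (‖pder u i x‖ ^ 2 + ‖pder u j x‖ ^ 2) / 2 := by
    intro j
    rw [abs_mul]
    have h1 := abs_real_inner_le_norm (pder u i x) (pder u j x)
    have h2 : |x j| * |⟪pder u i x, pder u j x⟫| ≤ 1 * |⟪pder u i x, pder u j x⟫| := by
      gcongr; exact hx j
    nlinarith [sq_nonneg (‖pder u i x‖ - ‖pder u j x‖)]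
  have hs : |∑ j, x j * ⟪pder u i x, pder u j x⟫| ≤ 3 / 2 * gradSq u x := by
    refine (Finset.abs_sum_le_sum_abs _ _).trans ?_
    refine (Finset.sum_le_sum fun j _ => hj j).trans ?_
    have hi : ‖pder u i x‖ ^ 2 ≤ gradSq u x :=
      Finset.single_le_sum (f := fun i => ‖pder u i x‖ ^ 2) (fun _ _ => by positivity)
        (Finset.mem_univ i)
    simp only [Fin.sum_univ_two, gradSq] at hi ⊢
    linarith
  unfold stressField
  refine (abs_sub _ _).trans ?_
  rw [abs_mul, abs_mul, abs_of_pos hε, abs_of_nonneg he0]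
  have h3 : |x i| * eDens V ε u x ≤ 1 * eDens V ε u x := by gcongr; exact hx i
  have h4 := mul_le_mul_of_nonneg_left hs hε.le
  linarith

end Calculus

section RadialTest

/-- The positive part squared. -/
def posSq (s : ℝ) : ℝ := (max 0 s) ^ 2

lemma hasDerivAt_posSq (s : ℝ) : HasDerivAt posSq (2 * max 0 s) s := by
  rcases lt_trichotomy s 0 with h | h | h
  · have h1 : posSq =ᶠ[𝓝 s] fun _ => 0 := by
      filter_upwards [gt_mem_nhds h] with t ht
      simp [posSq, max_eq_left ht.le]
    rw [max_eq_left h.le, mul_zero]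
    exact (hasDerivAt_const s (0 : ℝ)).congr_of_eventuallyEq h1
  · subst h
    rw [max_self, mul_zero, hasDerivAt_iff_isLittleO_nhds_zero]
    have h1 : (fun h : ℝ => posSq (0 + h) - posSq 0 - h • (0 : ℝ)) =O[𝓝 0] fun h : ℝ => h ^ 2 := by
      refine Asymptotics.IsBigO.of_bound 1 (Filter.Eventually.of_forall fun t => ?_)
      simp only [posSq, zero_add, max_self, smul_zero, ne_eq, OfNat.ofNat_ne_zero,
        not_false_eq_true, zero_pow, sub_zero, Real.norm_eq_abs, one_mul]
      rw [abs_of_nonneg (sq_nonneg _), abs_of_nonneg (sq_nonneg _)]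
      rcases le_total t 0 with ht | ht
      · simp [max_eq_left ht]; positivity
      · rw [max_eq_right ht]
    refine h1.trans_isLittleO ?_
    have := Asymptotics.isLittleO_pow_pow (𝕜 := ℝ) (m := 1) (n := 2) (by norm_num)
    simpa using this
  · have h1 : posSq =ᶠ[𝓝 s] fun t => t ^ 2 := by
      filter_upwards [lt_mem_nhds h] with t ht
      simp [posSq, max_eq_right ht.le]
    rw [max_eq_right h.le]
    have := (hasDerivAt_pow 2 s).congr_of_eventuallyEq h1
    simpa using this

lemma contDiff_posSq : ContDiff ℝ 1 posSq := by
  rw [contDiff_one_iff_deriv]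
  refine ⟨fun s => (hasDerivAt_posSq s).differentiableAt, ?_⟩
  have : deriv posSq = fun s => 2 * max 0 s := funext fun s => (hasDerivAt_posSq s).deriv
  rw [this]
  fun_prop

variable {k : ℕ} {V : Evec k → ℝ} {u : E2 → Evec k} {ε : ℝ} {σ : Evec k}

/-- The density obtained by testing the system against `G(|u - σ|²) (u - σ)`. -/
def radialTest (V : Evec k → ℝ) (ε : ℝ) (u : E2 → Evec k) (G G' : ℝ → ℝ) (σ : Evec k)
    (x : E2) : ℝ :=
  G (‖u x - σ‖ ^ 2) * ((ε ^ 2)⁻¹ * ⟪gradient V (u x), u x - σ⟫) +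
      ∑ i, (G (‖u x - σ‖ ^ 2) * ‖pder u i x‖ ^ 2 +
        2 * G' (‖u x - σ‖ ^ 2) * ⟪pder u i x, u x - σ⟫ ^ 2)

lemma continuous_radialTest (hV : ContDiff ℝ (⊤ : ℕ∞) V) (hu : ContDiff ℝ (⊤ : ℕ∞) u)
    {G G' : ℝ → ℝ} (hG : Continuous fun y : Evec k => G (‖y‖ ^ 2))
    (hG' : Continuous fun y : Evec k => G' (‖y‖ ^ 2)) :
    Continuous (radialTest V ε u G G' σ) := by
  have hw : Continuous fun x => u x - σ := hu.continuous.sub continuous_const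
  have h1 := hG.comp hw
  have h2 := hG'.comp hw
  have h3 : Continuous fun x => gradient V (u x) := (contDiff_gradient hV).continuous.comp hu.continuous
  have hp := fun i => (contDiff_pder hu i).continuous
  simp only [Function.comp_def] at h1 h2
  have hi : ∀ i, Continuous fun x => ⟪pder u i x, u x - σ⟫ := fun i => (hp i).inner hw
  have hj : Continuous fun x => ⟪gradient V (u x), u x - σ⟫ := h3.inner hw
  refine (h1.mul (continuous_const.mul hj)).add (continuous_finsetSum _ fun i _ => ?_)
  exact (h1.mul ((hp i).norm.pow 2)).add ((continuous_const.mul h2).mul ((hi i).pow 2))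

/-- Upper bound for the radially tested density in terms of the energy, when `G` is supported
near a well. -/
lemma integral_radialTest_le (hV0 : ∀ y, 0 ≤ V y) (hu : ContDiff ℝ (⊤ : ℕ∞) u) (hε : 0 < ε)
    {a : ℝ} (ha : 0 < a) (ha1 : a < 1)
    (hwell : ∀ y, ‖y - σ‖ ≤ a → a * ‖y - σ‖ ^ 2 ≤ V y)
    {G G' : ℝ → ℝ} (hG : ContDiff ℝ 1 fun y : Evec k => G (‖y‖ ^ 2))
    (hG' : ∀ s, 0 ≤ s → HasDerivAt G (G' s) s)
    (hG1 : ∀ s, 0 ≤ s → |G s| ≤ 1) (hGa : ∀ s, a ^ 2 ≤ s → G s = 0)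
    {φ : E2 → ℝ} (hφ : ContDiff ℝ 1 φ) (hc : HasCompactSupport φ)
    (hsol : ∀ x, φ x ≠ 0 → lap u x = (ε ^ 2)⁻¹ • gradient V (u x))
    {B : ℝ} (hB : 0 ≤ B) (hφB : ∀ x i, |fderiv ℝ φ x (b2 i)| ≤ B)
    {S : Set E2} (hS : MeasurableSet S) (hφS : ∀ x, x ∉ S → fderiv ℝ φ x = 0)
    (hInt : IntegrableOn (eDens V ε u) S) :
    ∫ x, φ x * radialTest V ε u G G' σ x ≤ 2 * B / a * ∫ x in S, eDens V ε u x := by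
  unfold radialTest
  rw [integral_test_radial hu hφ hc hsol hG hG' σ]
  rw [← integral_const_mul, ← integral_indicator hS]
  have hpt : ∀ x, |∑ i, fderiv ℝ φ x (b2 i) * (G (‖u x - σ‖ ^ 2) * ⟪pder u i x, u x - σ⟫)| ≤
      S.indicator (fun x => 2 * B / a * eDens V ε u x) x := by
    intro x
    by_cases hx : x ∈ S
    · rw [Set.indicator_of_mem hx]
      have he := eDens_nonneg hV0 hε u x
      have hi : ∀ i, |fderiv ℝ φ x (b2 i) * (G (‖u x - σ‖ ^ 2) * ⟪pder u i x, u x - σ⟫)| ≤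
          B / a * eDens V ε u x := by
        intro i
        rcases le_total (‖u x - σ‖) a with hd | hd
        · have hw := hwell (u x) hd
          rw [abs_mul, abs_mul]
          have h1 : |G (‖u x - σ‖ ^ 2)| * |⟪pder u i x, u x - σ⟫| ≤
              1 * (‖pder u i x‖ * ‖u x - σ‖) :=
            mul_le_mul (hG1 _ (by positivity)) (abs_real_inner_le_norm _ _) (abs_nonneg _)
              zero_le_one
          have h2 : a * (‖pder u i x‖ * ‖u x - σ‖) ≤ eDens V ε u x := by
            have hi : ‖pder u i x‖ ^ 2 ≤ gradSq u x :=
              Finset.single_le_sum (f := fun i => ‖pder u i x‖ ^ 2) (fun _ _ => by positivity)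
                (Finset.mem_univ i)
            have h3 : ε / 2 * ‖pder u i x‖ ^ 2 + ε⁻¹ * (a * ‖u x - σ‖ ^ 2) ≤ eDens V ε u x := by
              unfold eDens; gcongr
            refine le_trans ?_ h3
            have h4 : ε⁻¹ * (a * ‖u x - σ‖ ^ 2) = a * ε * (ε⁻¹ * ‖u x - σ‖) ^ 2 := by
              field_simp
            have h5 : a * (‖pder u i x‖ * ‖u x - σ‖) =
                a * ε * (‖pder u i x‖ * (ε⁻¹ * ‖u x - σ‖)) := by field_simp
            rw [h4, h5]
            have h6 := mul_nonneg (mul_pos ha hε).le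
              (sq_nonneg (‖pder u i x‖ - 2 * (ε⁻¹ * ‖u x - σ‖)))
            have h7 : a * ε * ‖pder u i x‖ ^ 2 ≤ ε * ‖pder u i x‖ ^ 2 := by
              have : 0 ≤ ε * ‖pder u i x‖ ^ 2 := by positivity
              nlinarith
            nlinarith
          have h8 : |G (‖u x - σ‖ ^ 2)| * |⟪pder u i x, u x - σ⟫| ≤ eDens V ε u x / a := by
            rw [le_div_iff₀ ha]; nlinarith
          calc _ ≤ B * (eDens V ε u x / a) := by
                gcongr; exact hφB x i
            _ = _ := by ring
        · rw [hGa _ (by gcongr)]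
          simp only [zero_mul, mul_zero, abs_zero]
          positivity
      refine (Finset.abs_sum_le_sum_abs _ _).trans ((Finset.sum_le_sum fun i _ => hi i).trans ?_)
      rw [Fin.sum_univ_two]
      apply le_of_eq; ring
    · rw [Set.indicator_of_notMem hx]
      simp [hφS x hx]
  have hI : Integrable (S.indicator (fun x => 2 * B / a * eDens V ε u x)) := by
    rw [integrable_indicator_iff hS]
    exact hInt.const_mul _
  refine (neg_le_abs _).trans ?_
  rw [← Real.norm_eq_abs]
  exact norm_integral_le_of_norm_le hI (Filter.Eventually.of_forall hpt)

end RadialTest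

section WellProfiles

/-- A `C¹` cut-off near a well, as a function of the squared distance. -/
def wellCutoff (a s : ℝ) : ℝ := posSq (1 - s / a ^ 2)

/-- The derivative of `wellCutoff`. -/
def wellCutoff' (a s : ℝ) : ℝ := -(2 / a ^ 2) * max 0 (1 - s / a ^ 2)

lemma hasDerivAt_wellCutoff (a s : ℝ) : HasDerivAt (wellCutoff a) (wellCutoff' a s) s := by
  have h1 : HasDerivAt (fun s : ℝ => 1 - s / a ^ 2) (-(1 / a ^ 2)) s := by
    have := ((hasDerivAt_id s).div_const (a ^ 2)).const_sub 1
    exact this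
  have := (hasDerivAt_posSq (1 - s / a ^ 2)).comp s h1
  refine this.congr_deriv ?_
  unfold wellCutoff'; ring

lemma contDiff_wellCutoff (a : ℝ) : ContDiff ℝ 1 (wellCutoff a) := by
  unfold wellCutoff
  refine contDiff_posSq.comp ?_
  fun_prop

lemma continuous_wellCutoff' (a : ℝ) : Continuous (wellCutoff' a) := by
  unfold wellCutoff'
  fun_prop

lemma wellCutoff_nonneg (a s : ℝ) : 0 ≤ wellCutoff a s := by
  unfold wellCutoff posSq; positivity

lemma wellCutoff_le_one (a : ℝ) {s : ℝ} (hs : 0 ≤ s) : wellCutoff a s ≤ 1 := by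
  have h0 : 0 ≤ s / a ^ 2 := by positivity
  have h : max 0 (1 - s / a ^ 2) ≤ 1 := max_le zero_le_one (by linarith)
  have h1 : 0 ≤ max 0 (1 - s / a ^ 2) := le_max_left _ _
  unfold wellCutoff posSq
  nlinarith

lemma one_sub_div_nonpos {a s : ℝ} (ha : 0 < a) (hs : a ^ 2 ≤ s) : 1 - s / a ^ 2 ≤ 0 := by
  have : 1 ≤ s / a ^ 2 := by rw [le_div_iff₀ (by positivity)]; linarith
  linarith

lemma wellCutoff_eq_zero {a s : ℝ} (ha : 0 < a) (hs : a ^ 2 ≤ s) : wellCutoff a s = 0 := by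
  simp [wellCutoff, posSq, max_eq_left (one_sub_div_nonpos ha hs)]

lemma wellCutoff'_eq_zero {a s : ℝ} (ha : 0 < a) (hs : a ^ 2 ≤ s) : wellCutoff' a s = 0 := by
  simp [wellCutoff', max_eq_left (one_sub_div_nonpos ha hs)]

/-- The profile `κ / √(κ² + s)` localized near a well. -/
def nearProfile (a κ s : ℝ) : ℝ := κ / √(κ ^ 2 + s) * wellCutoff a s

/-- The derivative of `nearProfile`. -/
def nearProfile' (a κ s : ℝ) : ℝ :=
  κ / √(κ ^ 2 + s) * (wellCutoff' a s - wellCutoff a s / (2 * (κ ^ 2 + s)))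

variable {a κ : ℝ}

lemma hasDerivAt_nearProfile (a : ℝ) (hκ : 0 < κ) {s : ℝ} (hs : 0 ≤ s) :
    HasDerivAt (nearProfile a κ) (nearProfile' a κ s) s := by
  have hp : 0 < κ ^ 2 + s := by positivity
  have hq : 0 < √(κ ^ 2 + s) := Real.sqrt_pos.2 hp
  have h1 : HasDerivAt (fun s => √(κ ^ 2 + s)) (1 / (2 * √(κ ^ 2 + s))) s :=
    ((hasDerivAt_id s).const_add (κ ^ 2)).sqrt hp.ne'
  have h2 := (((hasDerivAt_const s κ).div h1 hq.ne').mul (hasDerivAt_wellCutoff a s))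
  refine h2.congr_deriv ?_
  unfold nearProfile'
  have h3 : √(κ ^ 2 + s) ^ 2 = κ ^ 2 + s := Real.sq_sqrt hp.le
  simp only [Pi.div_apply]
  rw [h3]
  generalize √(κ ^ 2 + s) = q at hq h3
  rw [← h3]
  field_simp
  ring

lemma contDiff_nearProfile {k : ℕ} (a : ℝ) (hκ : 0 < κ) :
    ContDiff ℝ 1 fun y : Evec k => nearProfile a κ (‖y‖ ^ 2) := by
  unfold nearProfile
  have h1 : ContDiff ℝ 1 fun y : Evec k => ‖y‖ ^ 2 := contDiff_norm_sq ℝ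
  refine (contDiff_const.div ((contDiff_const.add h1).sqrt fun y => ?_) fun y => ?_).mul
    ((contDiff_wellCutoff a).comp h1) <;> positivity

lemma continuous_nearProfile' {k : ℕ} (a : ℝ) (hκ : 0 < κ) :
    Continuous fun y : Evec k => nearProfile' a κ (‖y‖ ^ 2) := by
  unfold nearProfile'
  have h1 : Continuous fun y : Evec k => ‖y‖ ^ 2 := by fun_prop
  refine (continuous_const.div (by fun_prop) fun y => ?_).mul
    (((continuous_wellCutoff' a).comp h1).sub
      (((contDiff_wellCutoff a).continuous.comp h1).div (by fun_prop) fun y => ?_)) <;> positivity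

lemma div_sqrt_le_one (hκ : 0 < κ) {s : ℝ} (hs : 0 ≤ s) : κ / √(κ ^ 2 + s) ≤ 1 := by
  have hp : 0 < κ ^ 2 + s := by positivity
  rw [div_le_one (Real.sqrt_pos.2 hp)]
  exact Real.le_sqrt_of_sq_le (by linarith)

lemma abs_nearProfile_le_one (a : ℝ) (hκ : 0 < κ) {s : ℝ} (hs : 0 ≤ s) :
    |nearProfile a κ s| ≤ 1 := by
  have h0 : 0 ≤ κ / √(κ ^ 2 + s) := by positivity
  unfold nearProfile
  rw [abs_of_nonneg (mul_nonneg h0 (wellCutoff_nonneg a s))]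
  exact mul_le_one₀ (div_sqrt_le_one hκ hs) (wellCutoff_nonneg a s) (wellCutoff_le_one a hs)

lemma nearProfile_eq_zero (κ : ℝ) {s : ℝ} (ha : 0 < a) (hs : a ^ 2 ≤ s) :
    nearProfile a κ s = 0 := by
  simp [nearProfile, wellCutoff_eq_zero ha hs]

lemma nearProfile'_eq_zero (κ : ℝ) {s : ℝ} (ha : 0 < a) (hs : a ^ 2 ≤ s) :
    nearProfile' a κ s = 0 := by
  simp [nearProfile', wellCutoff_eq_zero ha hs, wellCutoff'_eq_zero ha hs]

/-- The quadratic form attached to `nearProfile` is almost nonnegative. -/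
lemma nearProfile_quadratic {k : ℕ} (ha : 0 < a) (hκ : 0 < κ) (p w : Evec k) (hw : ‖w‖ < a) :
    (nearProfile a κ (‖w‖ ^ 2) * (κ ^ 2 / (κ ^ 2 + ‖w‖ ^ 2)) - 4 * κ / a) * ‖p‖ ^ 2 ≤
      nearProfile a κ (‖w‖ ^ 2) * ‖p‖ ^ 2 +
        2 * nearProfile' a κ (‖w‖ ^ 2) * ⟪p, w⟫ ^ 2 := by
  have hq : ⟪p, w⟫ ^ 2 ≤ ‖p‖ ^ 2 * ‖w‖ ^ 2 := by
    rw [← mul_pow, ← sq_abs]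
    gcongr
    exact abs_real_inner_le_norm p w
  set d := ‖w‖ with hd
  have hd0 : 0 ≤ d := norm_nonneg w
  have hs : 0 ≤ d ^ 2 := by positivity
  have hp : 0 < κ ^ 2 + d ^ 2 := by positivity
  have hz1 : d ^ 2 / a ^ 2 < 1 := by
    rw [div_lt_one (by positivity)]
    gcongr
  set N := κ / √(κ ^ 2 + d ^ 2) with hN
  have hN0 : 0 ≤ N := by positivity
  have hNd : N * d ≤ κ := by
    rw [hN, div_mul_eq_mul_div, div_le_iff₀ (Real.sqrt_pos.2 hp)]
    gcongr
    exact Real.le_sqrt_of_sq_le (by nlinarith)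
  set X := wellCutoff a (d ^ 2) with hX
  have hX0 : 0 ≤ X := wellCutoff_nonneg _ _
  have hX' : wellCutoff' a (d ^ 2) = -(2 / a ^ 2) * (1 - d ^ 2 / a ^ 2) := by
    rw [wellCutoff', max_eq_right (by linarith)]
  have e1 : nearProfile a κ (d ^ 2) = N * X := rfl
  have e2 : nearProfile' a κ (d ^ 2) =
      -(N * (2 / a ^ 2 * (1 - d ^ 2 / a ^ 2) + X / (2 * (κ ^ 2 + d ^ 2)))) := by
    rw [nearProfile', hX']; ring
  rw [e1, e2]
  have hc0 : 0 ≤ N * (2 / a ^ 2 * (1 - d ^ 2 / a ^ 2) + X / (2 * (κ ^ 2 + d ^ 2))) := by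
    have : 0 ≤ 1 - d ^ 2 / a ^ 2 := by linarith
    positivity
  have h1 := mul_le_mul_of_nonneg_left hq hc0
  have h2 : N * (d ^ 2 / a ^ 2) * (1 - d ^ 2 / a ^ 2) ≤ κ / a := by
    have h3 : N * (d ^ 2 / a ^ 2) ≤ κ / a := by
      have : N * (d ^ 2 / a ^ 2) = N * d * d / a / a := by ring
      rw [this]
      have h4 : N * d * d / a ≤ κ := by
        rw [div_le_iff₀ ha]
        gcongr
      gcongr
    have h5 : 0 ≤ N * (d ^ 2 / a ^ 2) := by positivity
    have h6 : 0 ≤ d ^ 2 / a ^ 2 := by positivity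
    nlinarith
  have h3 := mul_le_mul_of_nonneg_right h2 (sq_nonneg ‖p‖)
  have h4 : N * X * (κ ^ 2 / (κ ^ 2 + d ^ 2)) = N * X - N * X * d ^ 2 / (κ ^ 2 + d ^ 2) := by
    field_simp; ring
  have h5 : N * (2 / a ^ 2 * (1 - d ^ 2 / a ^ 2) + X / (2 * (κ ^ 2 + d ^ 2))) * (‖p‖ ^ 2 * d ^ 2) =
     2 * (N * (d ^ 2 / a ^ 2) * (1 - d ^ 2 / a ^ 2) * ‖p‖ ^ 2) +
       N * X * d ^ 2 / (κ ^ 2 + d ^ 2) * ‖p‖ ^ 2 / 2 := by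
    field_simp
  rw [h4]
  rw [h5] at h1
  have h6 : 4 * κ / a * ‖p‖ ^ 2 = 4 * (κ / a * ‖p‖ ^ 2) := by ring
  rw [sub_mul, sub_mul, h6]
  linarith

/-- The quadratic form attached to `wellCutoff`. -/
lemma wellCutoff_quadratic {k : ℕ} (ha : 0 < a) (p w : Evec k) (hw : ‖w‖ < a) :
    (1 - ‖w‖ ^ 2 / a ^ 2) * (1 - 5 * (‖w‖ ^ 2 / a ^ 2)) * ‖p‖ ^ 2 ≤
      wellCutoff a (‖w‖ ^ 2) * ‖p‖ ^ 2 + 2 * wellCutoff' a (‖w‖ ^ 2) * ⟪p, w⟫ ^ 2 := by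
  have hq : ⟪p, w⟫ ^ 2 ≤ ‖p‖ ^ 2 * ‖w‖ ^ 2 := by
    rw [← mul_pow, ← sq_abs]
    gcongr
    exact abs_real_inner_le_norm p w
  have hz1 : ‖w‖ ^ 2 / a ^ 2 < 1 := by
    rw [div_lt_one (by positivity)]
    gcongr
  have hX' : wellCutoff' a (‖w‖ ^ 2) = -(2 / a ^ 2) * (1 - ‖w‖ ^ 2 / a ^ 2) := by
    rw [wellCutoff', max_eq_right (by linarith)]
  have hX : wellCutoff a (‖w‖ ^ 2) = (1 - ‖w‖ ^ 2 / a ^ 2) ^ 2 := by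
    rw [wellCutoff, posSq, max_eq_right (by linarith)]
  have hc0 : 0 ≤ 4 / a ^ 2 * (1 - ‖w‖ ^ 2 / a ^ 2) := by
    have : 0 ≤ 1 - ‖w‖ ^ 2 / a ^ 2 := by linarith
    positivity
  have h1 := mul_le_mul_of_nonneg_left hq hc0
  rw [hX, hX']
  have h2 : 4 / a ^ 2 * (1 - ‖w‖ ^ 2 / a ^ 2) * (‖p‖ ^ 2 * ‖w‖ ^ 2) =
      4 * (‖w‖ ^ 2 / a ^ 2) * (1 - ‖w‖ ^ 2 / a ^ 2) * ‖p‖ ^ 2 := by ring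
  rw [h2] at h1
  have h3 : 2 * (-(2 / a ^ 2) * (1 - ‖w‖ ^ 2 / a ^ 2)) * ⟪p, w⟫ ^ 2 =
      -(4 / a ^ 2 * (1 - ‖w‖ ^ 2 / a ^ 2) * ⟪p, w⟫ ^ 2) := by ring
  rw [h3]
  generalize ‖w‖ ^ 2 / a ^ 2 = z at *
  linarith

end WellProfiles

section NearZone

lemma exists_cutoff {r R : ℝ} (hr : 0 < r) (hrR : r < R) :
    ∃ θ : E2 → ℝ, ∃ B > (0 : ℝ), ContDiff ℝ (⊤ : ℕ∞) θ ∧ HasCompactSupport θ ∧ (∀ x, 0 ≤ θ x) ∧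
      (∀ x, θ x ≤ 1) ∧ (∀ x ∈ closedBall (0 : E2) r, θ x = 1) ∧
      (∀ x, x ∉ ball (0 : E2) R → θ x = 0 ∧ fderiv ℝ θ x = 0) ∧
      ∀ x i, |fderiv ℝ θ x (b2 i)| ≤ B := by
  let f : ContDiffBump (0 : E2) := ⟨r, (r + R) / 2, hr, by linarith⟩
  have hf : ContDiff ℝ (⊤ : ℕ∞) f := f.contDiff
  have hc : HasCompactSupport f := f.hasCompactSupport
  have hd : Continuous (fderiv ℝ f) := hf.continuous_fderiv (by simp)
  obtain ⟨B, hB⟩ := hd.bounded_above_of_compact_support (hc.fderiv (𝕜 := ℝ))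
  refine ⟨f, max B 1, by positivity, hf, hc, fun x => f.nonneg, fun x => f.le_one,
    fun x hx => f.one_of_mem_closedBall hx, fun x hx => ?_, fun x i => ?_⟩
  · have h1 : x ∉ tsupport f := by
      rw [f.tsupport_eq]
      simp only [mem_closedBall, mem_ball, not_lt, not_le] at hx ⊢
      change (r + R) / 2 < _
      linarith
    exact ⟨image_eq_zero_of_notMem_tsupport h1, image_eq_zero_of_notMem_tsupport
      fun h => h1 (tsupport_fderiv_subset ℝ h)⟩
  · have := (fderiv ℝ f x).le_opNorm (b2 i)
    rw [norm_b2, mul_one] at this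
    exact this.trans ((hB x).trans (le_max_left _ _))

variable {k : ℕ} {V : Evec k → ℝ} {u : E2 → Evec k} {ε a κ : ℝ} {σ : Evec k}

/-- The radially tested density for `nearProfile`, corrected so as to be nonnegative. -/
def nearDensity (V : Evec k → ℝ) (ε : ℝ) (u : E2 → Evec k) (a κ : ℝ) (σ : Evec k) (x : E2) : ℝ :=
  ε * radialTest V ε u (nearProfile a κ) (nearProfile' a κ) σ x + 8 * κ / a * eDens V ε u x

lemma nearDensity_nonneg_and_le (hV0 : ∀ y, 0 ≤ V y) (hε : 0 < ε) (ha : 0 < a)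
    (hwell : ∀ y, ‖y - σ‖ ≤ a → a * ‖y - σ‖ ^ 2 ≤ ⟪gradient V y, y - σ⟫ ∧
      V y ≤ ‖y - σ‖ ^ 2 / a) (ha1 : a < 1) (hκ : 0 < κ) (hκa : κ ≤ a / 2) (x : E2) :
    0 ≤ nearDensity V ε u a κ σ x ∧
      (‖u x - σ‖ < κ → a ^ 2 / 4 * eDens V ε u x ≤ nearDensity V ε u a κ σ x) := by
  have he := eDens_nonneg hV0 hε u x
  have hVx := hV0 (u x)
  rcases le_or_gt a (‖u x - σ‖) with hd | hd
  · have hs : a ^ 2 ≤ ‖u x - σ‖ ^ 2 := by gcongr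
    have : nearDensity V ε u a κ σ x = 8 * κ / a * eDens V ε u x := by
      simp [nearDensity, radialTest, nearProfile_eq_zero κ ha hs, nearProfile'_eq_zero κ ha hs]
    rw [this]
    exact ⟨by positivity, fun h => by linarith⟩
  obtain ⟨hw1, hw2⟩ := hwell (u x) hd.le
  have hq := fun i => nearProfile_quadratic ha hκ (pder u i x) (u x - σ) hd
  have hN0 : 0 ≤ nearProfile a κ (‖u x - σ‖ ^ 2) :=
    mul_nonneg (by positivity) (wellCutoff_nonneg _ _)
  set N := nearProfile a κ (‖u x - σ‖ ^ 2) with hN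
  set d := ‖u x - σ‖ with hdd
  have hsum := Finset.sum_le_sum fun i (_ : i ∈ Finset.univ) => hq i
  rw [← Finset.mul_sum] at hsum
  have hg : ∑ i, ‖pder u i x‖ ^ 2 = gradSq u x := rfl
  rw [hg] at hsum
  have hg0 := gradSq_nonneg u x
  have hlow : ε * (N * ((ε ^ 2)⁻¹ * (a * d ^ 2))) +
      ε * ((N * (κ ^ 2 / (κ ^ 2 + d ^ 2)) - 4 * κ / a) * gradSq u x) +
      8 * κ / a * eDens V ε u x ≤ nearDensity V ε u a κ σ x := by
    unfold nearDensity radialTest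
    rw [← mul_add]
    gcongr
  have hed : 8 * κ / a * eDens V ε u x = 4 * κ / a * ε * gradSq u x +
      8 * κ / a * (ε⁻¹ * V (u x)) := by unfold eDens; ring
  have hpot : ε * (N * ((ε ^ 2)⁻¹ * (a * d ^ 2))) = N * (a * d ^ 2) * ε⁻¹ := by
    field_simp
  rw [hed, hpot] at hlow
  have hlow2 : N * (a * d ^ 2) * ε⁻¹ + N * (κ ^ 2 / (κ ^ 2 + d ^ 2)) * (ε * gradSq u x) +
      8 * κ / a * (ε⁻¹ * V (u x)) ≤ nearDensity V ε u a κ σ x := by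
    refine le_of_eq_of_le ?_ hlow
    ring
  have h8 : 0 ≤ 8 * κ / a * (ε⁻¹ * V (u x)) := by positivity
  refine ⟨le_trans (by positivity) hlow2, fun hdκ => ?_⟩
  have hd0 : 0 ≤ d := norm_nonneg _
  have hdk : d ^ 2 ≤ κ ^ 2 := by gcongr
  have hNlow : 3 / 8 ≤ N := by
    have h1 : 2 / 3 ≤ κ / √(κ ^ 2 + d ^ 2) := by
      rw [le_div_iff₀ (Real.sqrt_pos.2 (by positivity))]
      have : √(κ ^ 2 + d ^ 2) ≤ 3 / 2 * κ := by
        rw [Real.sqrt_le_left (by positivity)]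
        nlinarith
      linarith
    have h2 : 9 / 16 ≤ wellCutoff a (d ^ 2) := by
      have h3 : d ^ 2 / a ^ 2 ≤ 1 / 4 := by
        rw [div_le_iff₀ (by positivity)]
        nlinarith
      rw [wellCutoff, posSq, max_eq_right (by linarith)]
      nlinarith
    calc (3 / 8 : ℝ) = 2 / 3 * (9 / 16) := by norm_num
      _ ≤ _ := mul_le_mul h1 h2 (by norm_num) (by positivity)
  have hhalf : 1 / 2 ≤ κ ^ 2 / (κ ^ 2 + d ^ 2) := by
    rw [le_div_iff₀ (by positivity)]
    linarith
  have e1 : 3 / 8 * (1 / 2) * (ε * gradSq u x) ≤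
      N * (κ ^ 2 / (κ ^ 2 + d ^ 2)) * (ε * gradSq u x) := by gcongr
  have hVd : a * V (u x) ≤ d ^ 2 := by
    rw [le_div_iff₀ ha] at hw2; linarith
  have e2 : 3 / 8 * (a * (a * V (u x))) * ε⁻¹ ≤ N * (a * d ^ 2) * ε⁻¹ := by gcongr
  have ha2 : a ^ 2 ≤ 1 := by nlinarith
  have hEg : 0 ≤ ε * gradSq u x := by positivity
  have hEV : 0 ≤ ε⁻¹ * V (u x) := by positivity
  have e3 := mul_le_mul_of_nonneg_right ha2 hEg
  have e4 := mul_nonneg (sq_nonneg a) hEV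
  have e5 : 3 / 8 * (a * (a * V (u x))) * ε⁻¹ = 3 / 8 * (a ^ 2 * (ε⁻¹ * V (u x))) := by ring
  have e6 : a ^ 2 / 4 * eDens V ε u x =
      1 / 8 * (a ^ 2 * (ε * gradSq u x)) + 1 / 4 * (a ^ 2 * (ε⁻¹ * V (u x))) := by
    unfold eDens; ring
  rw [e6]
  rw [e5] at e2
  linarith

lemma continuous_nearDensity (hV : ContDiff ℝ (⊤ : ℕ∞) V) (hu : ContDiff ℝ (⊤ : ℕ∞) u)
    (hκ : 0 < κ) : Continuous (nearDensity V ε u a κ σ) :=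
  (continuous_const.mul (continuous_radialTest hV hu (contDiff_nearProfile a hκ).continuous
    (continuous_nearProfile' a hκ))).add (continuous_const.mul (continuous_eDens hV hu ε))

lemma integrableOn_eDens_ball (hV : ContDiff ℝ (⊤ : ℕ∞) V) (hu : ContDiff ℝ (⊤ : ℕ∞) u)
    (ε : ℝ) (x : E2) (r : ℝ) : IntegrableOn (eDens V ε u) (ball x r) :=
  ((continuous_eDens hV hu ε).continuousOn.integrableOn_compact
    (isCompact_closedBall x r)).mono_set ball_subset_closedBall

lemma setIntegral_eDens_nonneg (hV0 : ∀ y, 0 ≤ V y) (hε : 0 < ε) (u : E2 → Evec k) (S : Set E2) :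
    0 ≤ ∫ x in S, eDens V ε u x :=
  integral_nonneg fun x => eDens_nonneg hV0 hε u x

/-- The energy carried by the region where `u` is close to the wells is small compared with the
total energy. -/
lemma IsMultiWell.exists_near_zone_bound (hV : IsMultiWell V) (ha : 0 < a) (ha1 : a < 1)
    (hwell : ∀ σ, V σ = 0 → ∀ y, ‖y - σ‖ ≤ a → a * ‖y - σ‖ ^ 2 ≤ ⟪gradient V y, y - σ⟫ ∧
      ‖gradient V y‖ ≤ ‖y - σ‖ / a ∧ a * ‖y - σ‖ ^ 2 ≤ V y ∧ V y ≤ ‖y - σ‖ ^ 2 / a) :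
    ∃ C > (0 : ℝ), ∀ κ > (0 : ℝ), κ ≤ a / 2 → ∀ ε > (0 : ℝ), ∀ u : E2 → Evec k,
      ContDiff ℝ (⊤ : ℕ∞) u →
      (∀ x ∈ ball (0 : E2) 3, lap u x = (ε ^ 2)⁻¹ • gradient V (u x)) →
      ∀ ψ : E2 → ℝ, (∀ x, |ψ x| ≤ eDens V ε u x) →
        (∀ x, ψ x ≠ 0 → x ∈ closedBall (0 : E2) 2 ∧ ∃ σ, V σ = 0 ∧ ‖u x - σ‖ < κ) →
        |∫ x, ψ x| ≤ C * (κ + ε) * ∫ x in ball (0 : E2) 3, eDens V ε u x := by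
  obtain ⟨θ, B, hB, hθ, hθc, hθ0, hθ1, hθin, hθout, hθB⟩ :=
    exists_cutoff (r := 2) (R := 3) (by norm_num) (by norm_num)
  set Z := hV.finite_zeros.toFinset with hZ
  have hmem : ∀ σ, σ ∈ Z ↔ V σ = 0 := fun σ => by simp [hZ]
  have hVs := hV.smooth
  have hV0 := hV.nonneg
  refine ⟨4 / a ^ 2 * ((Z.card + 1) * (2 * B / a + 8 / a)), by positivity, ?_⟩
  intro κ hκ hκa ε hε u hu hsol ψ hψ hψ'
  set E := ∫ x in ball (0 : E2) 3, eDens V ε u x with hE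
  have hE0 : 0 ≤ E := setIntegral_eDens_nonneg hV0 hε u _
  have hLc : ∀ σ, Continuous (nearDensity V ε u a κ σ) :=
    fun σ => continuous_nearDensity hVs hu hκ
  have hLint : ∀ σ, Integrable fun x => θ x * nearDensity V ε u a κ σ x := fun σ =>
    (hθ.continuous.mul (hLc σ)).integrable_of_hasCompactSupport hθc.mul_right
  have hL : ∀ σ, V σ = 0 → ∀ x, 0 ≤ nearDensity V ε u a κ σ x ∧
      (‖u x - σ‖ < κ → a ^ 2 / 4 * eDens V ε u x ≤ nearDensity V ε u a κ σ x) := fun σ hσ x =>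
    nearDensity_nonneg_and_le hV0 hε ha
      (fun y hy => ⟨(hwell σ hσ y hy).1, (hwell σ hσ y hy).2.2.2⟩) ha1 hκ hκa x
  have heint : Integrable fun x => θ x * eDens V ε u x :=
    (hθ.continuous.mul (continuous_eDens hVs hu ε)).integrable_of_hasCompactSupport hθc.mul_right
  have hθe : ∫ x, θ x * eDens V ε u x ≤ E := by
    rw [hE, ← integral_indicator measurableSet_ball]
    refine integral_mono heint ((integrableOn_eDens_ball hVs hu ε _ _).integrable_indicator
      measurableSet_ball) fun x => ?_
    by_cases hx : x ∈ ball (0 : E2) 3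
    · rw [Set.indicator_of_mem hx]
      exact mul_le_of_le_one_left (eDens_nonneg hV0 hε u x) (hθ1 x)
    · rw [Set.indicator_of_notMem hx]
      simp [(hθout x hx).1]
  have hLE : ∀ σ, V σ = 0 → ∫ x, θ x * nearDensity V ε u a κ σ x ≤
      (2 * B / a + 8 / a) * (κ + ε) * E := by
    intro σ hσ
    have h1 := integral_radialTest_le (V := V) hV0 hu hε ha ha1
      (fun y hy => (hwell σ hσ y hy).2.2.1) (contDiff_nearProfile a hκ)
      (fun s hs => hasDerivAt_nearProfile a hκ hs) (fun s hs => abs_nearProfile_le_one a hκ hs)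
      (fun s hs => nearProfile_eq_zero κ ha hs) (hθ.of_le (by simp)) hθc
      (fun x hx => hsol x (by by_contra h; exact hx (hθout x h).1)) hB.le hθB
      measurableSet_ball (fun x hx => (hθout x hx).2) (integrableOn_eDens_ball hVs hu ε _ _)
    have h2 : ∫ x, θ x * nearDensity V ε u a κ σ x =
        ε * (∫ x, θ x * radialTest V ε u (nearProfile a κ) (nearProfile' a κ) σ x) +
          8 * κ / a * ∫ x, θ x * eDens V ε u x := by
      rw [← integral_const_mul, ← integral_const_mul, ← integral_add]
      · refine integral_congr_ae (Filter.Eventually.of_forall fun x => ?_)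
        simp only [nearDensity]; ring
      · exact ((hθ.continuous.mul (continuous_radialTest hVs hu
          (contDiff_nearProfile a hκ).continuous
          (continuous_nearProfile' a hκ))).integrable_of_hasCompactSupport hθc.mul_right).const_mul _
      · exact heint.const_mul _
    rw [h2]
    have h3 := mul_le_mul_of_nonneg_left h1 hε.le
    have h4 : 8 * κ / a * ∫ x, θ x * eDens V ε u x ≤ 8 * κ / a * E := by gcongr
    have h5 : 0 ≤ 2 * B / a * κ * E := by positivity
    have h6 : 0 ≤ 8 / a * ε * E := by positivity
    have h7 : (2 * B / a + 8 / a) * (κ + ε) * E = ε * (2 * B / a * E) + 8 * κ / a * E +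
      2 * B / a * κ * E + 8 / a * ε * E := by ring
    rw [h7]; linarith
  have hpt : ∀ x, ‖ψ x‖ ≤ 4 / a ^ 2 * ∑ σ ∈ Z, θ x * nearDensity V ε u a κ σ x := by
    intro x
    have hnn : ∀ σ ∈ Z, 0 ≤ θ x * nearDensity V ε u a κ σ x := fun σ hσ =>
      mul_nonneg (hθ0 x) (hL σ ((hmem σ).1 hσ) x).1
    by_cases hx : ψ x = 0
    · rw [hx, norm_zero]
      exact mul_nonneg (by positivity) (Finset.sum_nonneg hnn)
    · obtain ⟨hx2, σ, hσ, hσκ⟩ := hψ' x hx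
      have h1 := (hL σ hσ x).2 hσκ
      have h2 := Finset.single_le_sum hnn ((hmem σ).2 hσ)
      simp only [hθin x hx2, one_mul] at h2 ⊢
      refine (hψ x).trans ?_
      calc eDens V ε u x = 4 / a ^ 2 * (a ^ 2 / 4 * eDens V ε u x) := by field_simp
        _ ≤ _ := by gcongr; exact h1.trans h2
  have hsumint : Integrable fun x => 4 / a ^ 2 * ∑ σ ∈ Z, θ x * nearDensity V ε u a κ σ x :=
    (integrable_finsetSum _ fun σ _ => hLint σ).const_mul _
  have h1 := norm_integral_le_of_norm_le hsumint (Filter.Eventually.of_forall hpt)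
  rw [Real.norm_eq_abs, integral_const_mul, integral_finsetSum _ fun σ _ => hLint σ] at h1
  refine h1.trans ?_
  have h2 : ∑ σ ∈ Z, ∫ x, θ x * nearDensity V ε u a κ σ x ≤
      Z.card • ((2 * B / a + 8 / a) * (κ + ε) * E) :=
    Finset.sum_le_card_nsmul _ _ _ fun σ hσ => hLE σ ((hmem σ).1 hσ)
  rw [nsmul_eq_mul] at h2
  have h3 : 0 ≤ (2 * B / a + 8 / a) * (κ + ε) * E := by positivity
  calc 4 / a ^ 2 * ∑ σ ∈ Z, ∫ x, θ x * nearDensity V ε u a κ σ x ≤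
      4 / a ^ 2 * ((Z.card + 1) * ((2 * B / a + 8 / a) * (κ + ε) * E)) := by
        gcongr; linarith
    _ = _ := by ring

end NearZone

section GoodLines

/-- A function whose derivative is controlled by an integrable density wherever the function is
at most one stays small if the density has small integral. -/
lemma le_of_deriv_le_of_integral_lt {f g : ℝ → ℝ} (hf : ContDiff ℝ 1 f) (hg : Continuous g)
    (hf0 : ∀ t, 0 ≤ f t) (hfg : ∀ t, f t ≤ g t) {C lam δ : ℝ} (hC : 0 ≤ C)
    (hf' : ∀ t, f t ≤ 1 → |deriv f t| ≤ C * g t) (hInt : ∫ t in Set.Icc (-1 : ℝ) 1, g t < lam)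
    (hδ : (2 + 2 * C) * lam ≤ δ) (hδ1 : δ < 1) {t : ℝ} (ht : t ∈ Set.Icc (-1 : ℝ) 1) :
    f t ≤ δ := by
  have hg0 : ∀ t, 0 ≤ g t := fun t => (hf0 t).trans (hfg t)
  have hgi : IntegrableOn g (Set.Icc (-1 : ℝ) 1) := hg.continuousOn.integrableOn_Icc
  obtain ⟨t₀, ht₀, hmin⟩ := isCompact_Icc.exists_isMinOn (Set.nonempty_of_mem ht)
    hf.continuous.continuousOn
  have h0 : f t₀ ≤ lam := by
    have h1 : ∫ _ in Set.Icc (-1 : ℝ) 1, f t₀ ≤ ∫ t in Set.Icc (-1 : ℝ) 1, g t :=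
      setIntegral_mono_on (integrableOn_const (by simp)) hgi measurableSet_Icc
        fun t ht => (hmin ht).trans (hfg t)
    rw [setIntegral_const, smul_eq_mul] at h1
    have h2 : volume.real (Set.Icc (-1 : ℝ) 1) = 2 := by
      rw [Real.volume_real_Icc_of_le (by norm_num)]; norm_num
    rw [h2] at h1
    have := hf0 t₀
    linarith
  set F : ℝ → ℝ := fun t => 1 - posSq (1 - f t) with hF
  have hFd : ∀ t, HasDerivAt F (2 * max 0 (1 - f t) * deriv f t) t := by
    intro t
    have h1 := ((hf.differentiable (by simp) t).hasDerivAt.const_sub 1)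
    have h2 := ((hasDerivAt_posSq (1 - f t)).comp t h1).const_sub 1
    exact h2.congr_deriv (by ring)
  have hFc : Continuous fun t => 2 * max 0 (1 - f t) * deriv f t := by
    have h1 := hf.continuous
    have h2 := hf.continuous_deriv (by simp)
    fun_prop
  have hFb : ∀ t, ‖2 * max 0 (1 - f t) * deriv f t‖ ≤ 2 * C * g t := by
    intro t
    rcases le_or_gt (f t) 1 with h | h
    · have h1 : 0 ≤ 1 - f t := by linarith
      rw [max_eq_right h1, Real.norm_eq_abs, abs_mul, abs_mul, abs_of_nonneg h1, abs_two]
      have h2 : (1 - f t) * |deriv f t| ≤ 1 * (C * g t) :=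
        mul_le_mul (by linarith [hf0 t]) (hf' t h) (abs_nonneg _) zero_le_one
      nlinarith
    · rw [max_eq_left (by linarith)]
      simp only [mul_zero, zero_mul, norm_zero]
      have := hg0 t
      positivity
  have hFt : F t - F t₀ = ∫ s in t₀..t, 2 * max 0 (1 - f s) * deriv f s :=
    (intervalIntegral.integral_eq_sub_of_hasDerivAt (fun s _ => hFd s)
      (hFc.intervalIntegrable _ _)).symm
  have hFle : F t - F t₀ ≤ 2 * C * lam := by
    rw [hFt]
    refine (le_abs_self _).trans ?_
    rw [← Real.norm_eq_abs]
    refine (intervalIntegral.norm_integral_le_integral_norm_uIoc).trans ?_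
    have hsub : Set.uIoc t₀ t ⊆ Set.Icc (-1 : ℝ) 1 :=
      Set.uIoc_subset_uIcc.trans (Set.uIcc_subset_Icc ht₀ ht)
    have h1 : ∫ s in Set.uIoc t₀ t, ‖2 * max 0 (1 - f s) * deriv f s‖ ≤
        ∫ s in Set.uIoc t₀ t, 2 * C * g s :=
      setIntegral_mono_on ((hFc.norm.continuousOn.integrableOn_Icc).mono_set hsub)
        ((hgi.mono_set hsub).const_mul _) measurableSet_uIoc fun s _ => hFb s
    have h2 : ∫ s in Set.uIoc t₀ t, 2 * C * g s ≤ ∫ s in Set.Icc (-1 : ℝ) 1, 2 * C * g s :=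
      setIntegral_mono_set (hgi.const_mul _) (Filter.Eventually.of_forall fun s => by
        have := hg0 s
        change 0 ≤ 2 * C * g s
        positivity) hsub.eventuallyLE
    simp only [integral_const_mul] at h1 h2
    have h3 : 2 * C * ∫ s in Set.Icc (-1 : ℝ) 1, g s ≤ 2 * C * lam := by gcongr
    linarith
  have hF0 : F t₀ ≤ 2 * f t₀ := by
    simp only [hF, posSq]
    rcases le_total (f t₀) 1 with h | h
    · rw [max_eq_right (by linarith)]; nlinarith [hf0 t₀]
    · rw [max_eq_left (by linarith)]; linarith
  have hFδ : F t ≤ δ := by linarith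
  simp only [hF, posSq] at hFδ
  rcases le_total (f t) 1 with h | h
  · rw [max_eq_right (by linarith)] at hFδ
    nlinarith [hf0 t]
  · rw [max_eq_left (by linarith)] at hFδ
    linarith

/-- A `C¹` step function increasing only where a given density is small. -/
lemma exists_good_step {l : ℝ → ℝ} (hl : Continuous l) (hl0 : ∀ t, 0 ≤ l t) {lam : ℝ}
    (hlam : 0 < lam) (hInt : ∫ t in Set.Icc (-1 : ℝ) 1, l t ≤ lam / 32) :
    ∃ L : ℝ → ℝ, ContDiff ℝ 1 L ∧ (∀ t, 0 ≤ L t) ∧ (∀ t, L t ≤ 1) ∧ (∀ t ≤ -1, L t = 0) ∧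
      (∀ t, -(3 / 4) ≤ t → 1 / 32 ≤ L t) ∧ (∀ t, |deriv L t| ≤ 1) ∧
      ∀ t, deriv L t ≠ 0 → l t < lam := by
  set w : ℝ → ℝ := fun t => max 0 (1 - 8 * |t + 7 / 8|) with hw
  set h : ℝ → ℝ := fun t => max 0 (1 - l t / lam) with hh
  have hwc : Continuous w := by fun_prop
  have hhc : Continuous h := by fun_prop
  have hw0 : ∀ t, 0 ≤ w t := fun t => le_max_left _ _
  have hh0 : ∀ t, 0 ≤ h t := fun t => le_max_left _ _
  have hw1 : ∀ t, w t ≤ 1 := fun t => max_le zero_le_one (by linarith [abs_nonneg (t + 7 / 8)])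
  have hh1 : ∀ t, h t ≤ 1 := fun t => max_le zero_le_one (by
    have : 0 ≤ l t / lam := div_nonneg (hl0 t) hlam.le
    linarith)
  have hwl : ∀ t ≤ -1, w t = 0 := by
    intro t ht
    refine max_eq_left ?_
    rw [abs_of_nonpos (by linarith)]; linarith
  have hwr : ∀ t, -(3 / 4) ≤ t → w t = 0 := by
    intro t ht
    refine max_eq_left ?_
    rw [abs_of_nonneg (by linarith)]; linarith
  have hc : Continuous fun t => w t * h t := hwc.mul hhc
  set L : ℝ → ℝ := fun t => ∫ s in (-1)..t, w s * h s with hL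
  have hLd : ∀ t, HasDerivAt L (w t * h t) t := fun t =>
    intervalIntegral.integral_hasDerivAt_right (hc.intervalIntegrable _ _)
      hc.stronglyMeasurable.stronglyMeasurableAtFilter hc.continuousAt
  have hLderiv : deriv L = fun t => w t * h t := funext fun t => (hLd t).deriv
  have hmono : Monotone L := monotone_of_deriv_nonneg (fun t => (hLd t).differentiableAt)
    fun t => by rw [hLderiv]; exact mul_nonneg (hw0 t) (hh0 t)
  have hLl : ∀ t ≤ -1, L t = 0 := by
    intro t ht
    simp only [hL]
    rw [intervalIntegral.integral_symm, neg_eq_zero]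
    refine intervalIntegral.integral_zero_ae (Filter.Eventually.of_forall fun s hs => ?_)
    rw [Set.uIoc_of_le ht] at hs
    rw [hwl s hs.2, zero_mul]
  have hLr : ∀ t, -(3 / 4) ≤ t → L t = L (-(3 / 4)) := by
    intro t ht
    simp only [hL]
    rw [← intervalIntegral.integral_add_adjacent_intervals (b := -(3 / 4))
      (hc.intervalIntegrable _ _) (hc.intervalIntegrable _ _), add_eq_left]
    refine intervalIntegral.integral_zero_ae (Filter.Eventually.of_forall fun s hs => ?_)
    rw [Set.uIoc_of_le ht] at hs
    rw [hwr s hs.1.le, zero_mul]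
  have hLup : L (-(3 / 4)) ≤ 1 := by
    have := intervalIntegral.norm_integral_le_of_norm_le_const (a := -1) (b := -(3 / 4 : ℝ))
      (f := fun s => w s * h s) (C := 1) fun s _ => by
        rw [Real.norm_eq_abs, abs_of_nonneg (mul_nonneg (hw0 s) (hh0 s))]
        exact mul_le_one₀ (hw1 s) (hh0 s) (hh1 s)
    refine (le_abs_self _).trans (this.trans ?_)
    norm_num [abs_of_nonneg]
  have hLlow : 1 / 32 ≤ L (-(3 / 4)) := by
    have h1 : ∫ s in (-1)..(-(3 / 4)), w s * (1 - l s / lam) ≤ L (-(3 / 4)) := by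
      refine intervalIntegral.integral_mono_on (by norm_num)
        ((by fun_prop : Continuous fun s => w s * (1 - l s / lam)).intervalIntegrable _ _)
        (hc.intervalIntegrable _ _) fun s _ => ?_
      exact mul_le_mul_of_nonneg_left (le_max_right _ _) (hw0 s)
    have h2 : ∫ s in (-1)..(-(3 / 4)), w s * (1 - l s / lam) =
        (∫ s in (-1)..(-(3 / 4)), w s) - lam⁻¹ * ∫ s in (-1)..(-(3 / 4)), w s * l s := by
      rw [← intervalIntegral.integral_const_mul, ← intervalIntegral.integral_sub
        (hwc.intervalIntegrable _ _)
        ((by fun_prop : Continuous fun s => lam⁻¹ * (w s * l s)).intervalIntegrable _ _)]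
      congr 1; ext s; ring
    have h3 : 1 / 16 ≤ ∫ s in (-1)..(-(3 / 4)), w s := by
      have h4 : ∫ s in (-(15 / 16))..(-(13 / 16)), (1 / 2 : ℝ) ≤
          ∫ s in (-(15 / 16))..(-(13 / 16)), w s := by
        refine intervalIntegral.integral_mono_on (by norm_num) (by simp)
          (hwc.intervalIntegrable _ _) fun s hs => ?_
        refine le_max_of_le_right ?_
        have : |s + 7 / 8| ≤ 1 / 16 := abs_le.2 ⟨by linarith [hs.1], by linarith [hs.2]⟩
        linarith
      have h5 : ∫ s in (-(15 / 16))..(-(13 / 16)), w s ≤ ∫ s in (-1)..(-(3 / 4)), w s :=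
        intervalIntegral.integral_mono_interval (by norm_num) (by norm_num) (by norm_num)
          (Filter.Eventually.of_forall hw0) (hwc.intervalIntegrable _ _)
      rw [intervalIntegral.integral_const, smul_eq_mul] at h4
      linarith
    have h6 : ∫ s in (-1)..(-(3 / 4)), w s * l s ≤ lam / 32 := by
      rw [intervalIntegral.integral_of_le (by norm_num)]
      have h7 : ∫ s in Set.Ioc (-1) (-(3 / 4)), w s * l s ≤
          ∫ s in Set.Ioc (-1) (-(3 / 4)), l s :=
        setIntegral_mono_on
          (((hwc.mul hl).continuousOn.integrableOn_Icc).mono_set Set.Ioc_subset_Icc_self)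
          ((hl.continuousOn.integrableOn_Icc).mono_set Set.Ioc_subset_Icc_self)
          measurableSet_Ioc fun s _ => mul_le_of_le_one_left (hl0 s) (hw1 s)
      have h8 : ∫ s in Set.Ioc (-1) (-(3 / 4)), l s ≤ ∫ s in Set.Icc (-1 : ℝ) 1, l s :=
        setIntegral_mono_set hl.continuousOn.integrableOn_Icc
          (Filter.Eventually.of_forall fun s => hl0 s) (LE.le.eventuallyLE fun s hs =>
            ⟨hs.1.le, by linarith [hs.2]⟩)
      linarith
    have h9 : lam⁻¹ * ∫ s in (-1)..(-(3 / 4)), w s * l s ≤ lam⁻¹ * (lam / 32) := by gcongr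
    have h10 : lam⁻¹ * (lam / 32) = 1 / 32 := by field_simp
    linarith
  refine ⟨L, ?_, fun t => ?_, fun t => ?_, hLl, fun t ht => ?_, fun t => ?_, fun t ht => ?_⟩
  · rw [contDiff_one_iff_deriv]
    exact ⟨fun t => (hLd t).differentiableAt, by rw [hLderiv]; exact hc⟩
  · rw [← hLl (min t (-1)) (min_le_right _ _)]
    exact hmono (min_le_left _ _)
  · rcases le_total t (-(3 / 4)) with ht | ht
    · exact (hmono ht).trans hLup
    · rw [hLr t ht]; exact hLup
  · rw [hLr t ht]; exact hLlow
  · rw [hLderiv, abs_of_nonneg (mul_nonneg (hw0 t) (hh0 t))]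
    exact mul_le_one₀ (hw1 t) (hh0 t) (hh1 t)
  · rw [hLderiv] at ht
    by_contra hcon
    refine ht ?_
    have : h t = 0 := max_eq_left (by
      have : 1 ≤ l t / lam := by rw [le_div_iff₀ hlam]; linarith
      linarith)
    simp [this]

/-- A `C¹` bump function on the line varying only where a given density is small. -/
lemma exists_good_bump {l : ℝ → ℝ} (hl : Continuous l) (hl0 : ∀ t, 0 ≤ l t) {lam : ℝ}
    (hlam : 0 < lam) (hInt : ∫ t in Set.Icc (-1 : ℝ) 1, l t ≤ lam / 32) :
    ∃ A : ℝ → ℝ, ContDiff ℝ 1 A ∧ (∀ t, 0 ≤ A t) ∧ (∀ t, A t ≤ 1) ∧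
      (∀ t, A t ≠ 0 → |t| ≤ 1) ∧ (∀ t, |t| ≤ 3 / 4 → 1 / 1024 ≤ A t) ∧ (∀ t, |deriv A t| ≤ 2) ∧
      ∀ t, deriv A t ≠ 0 → |t| ≤ 1 ∧ l t < lam := by
  obtain ⟨L, hL, hL0, hL1, hLl, hLlow, hLd, hLg⟩ := exists_good_step hl hl0 hlam hInt
  have hInt' : ∫ t in Set.Icc (-1 : ℝ) 1, l (-t) ≤ lam / 32 := by
    rw [integral_Icc_eq_integral_Ioc, ← intervalIntegral.integral_of_le (by norm_num)] at hInt ⊢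
    rw [intervalIntegral.integral_comp_neg]
    simpa using hInt
  obtain ⟨R, hR, hR0, hR1, hRl, hRlow, hRd, hRg⟩ :=
    exists_good_step (hl.comp continuous_neg) (fun t => hl0 (-t)) hlam hInt'
  have hRn : ContDiff ℝ 1 fun t => R (-t) := hR.comp contDiff_neg
  have hd : ∀ t, HasDerivAt (fun t => L t * R (-t)) (deriv L t * R (-t) - L t * deriv R (-t)) t := by
    intro t
    have h1 : HasDerivAt (fun t => R (-t)) (deriv R (-t) * -1) t :=
      ((hR.differentiable (by simp) (-t)).hasDerivAt).comp t (hasDerivAt_neg t)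
    refine ((hL.differentiable (by simp) t).hasDerivAt.mul h1).congr_deriv ?_
    ring
  refine ⟨fun t => L t * R (-t), hL.mul hRn, fun t => mul_nonneg (hL0 t) (hR0 _),
    fun t => mul_le_one₀ (hL1 t) (hR0 _) (hR1 _), ?_, ?_, ?_, ?_⟩
  · intro t ht
    by_contra hcon
    refine ht ?_
    rw [abs_le, not_and_or, not_le, not_le] at hcon
    rcases hcon with h | h
    · simp [hLl t h.le]
    · simp [hRl (-t) (by linarith)]
  · intro t ht
    rw [abs_le] at ht
    have h1 := hLlow t ht.1
    have h2 := hRlow (-t) (by linarith)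
    calc (1 / 1024 : ℝ) = 1 / 32 * (1 / 32) := by norm_num
      _ ≤ _ := mul_le_mul h1 h2 (by norm_num) (hL0 t)
  · intro t
    rw [(hd t).deriv]
    refine (abs_sub _ _).trans ?_
    rw [abs_mul, abs_mul, abs_of_nonneg (hL0 t), abs_of_nonneg (hR0 _)]
    have h1 := mul_le_one₀ (hLd t) (hR0 (-t)) (hR1 (-t))
    have h2 := mul_le_one₀ (hL1 t) (abs_nonneg _) (hRd (-t))
    linarith
  · intro t ht
    rw [(hd t).deriv] at ht
    have hA : t ∉ Set.Icc (-1 : ℝ) 1 → False := by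
      intro hcon
      have hev : (fun t => L t * R (-t)) =ᶠ[𝓝 t] fun _ => 0 := by
        filter_upwards [isClosed_Icc.isOpen_compl.mem_nhds hcon] with s hs
        rw [Set.mem_compl_iff, Set.mem_Icc, not_and_or, not_le, not_le] at hs
        rcases hs with h | h
        · simp [hLl s h.le]
        · simp [hRl (-s) (by linarith)]
      have := hev.deriv_eq
      rw [(hd t).deriv] at this
      simp at this
      exact ht this
    refine ⟨abs_le.2 (by_contra hA), ?_⟩
    by_cases h1 : deriv L t = 0
    · have h2 : deriv R (-t) ≠ 0 := fun h => ht (by simp [h1, h])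
      simpa using hRg (-t) h2
    · exact hLg t h1

end GoodLines

section GoodCutoff

/-- The point of the plane with coordinates `t` in direction `i` and `s` in the other one. -/
def planePt (i : Fin 2) (t s : ℝ) : E2 := t • b2 i + s • b2 (i + 1)

lemma planePt_apply_self (i : Fin 2) (t s : ℝ) : planePt i t s i = t := by
  fin_cases i <;> simp [planePt, b2_apply]

lemma planePt_apply_succ (i : Fin 2) (t s : ℝ) : planePt i t s (i + 1) = s := by
  fin_cases i <;> simp [planePt, b2_apply]

lemma planePt_eta (i : Fin 2) (x : E2) : planePt i (x i) (x (i + 1)) = x := by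
  ext j
  fin_cases i <;> fin_cases j <;> simp [planePt, b2_apply]

lemma measurePreserving_planePt (i : Fin 2) :
    MeasurePreserving (fun p : ℝ × ℝ => planePt i p.1 p.2) := by
  have h0 : MeasurePreserving (fun p : ℝ × ℝ => planePt 0 p.1 p.2) := by
    have h1 := (EuclideanSpace.volume_preserving_symm_measurableEquiv_toLp (Fin 2)).symm
    have h2 := (volume_preserving_finTwoArrow ℝ).symm
    have h3 : (fun p : ℝ × ℝ => planePt 0 p.1 p.2) =
        (MeasurableEquiv.toLp 2 (Fin 2 → ℝ)).symm.symm ∘ MeasurableEquiv.finTwoArrow.symm := by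
      ext p j
      fin_cases j <;> simp [planePt, b2_apply]
    rw [h3]
    exact h1.comp h2
  fin_cases i
  · exact h0
  · have h1 : MeasurePreserving (Prod.swap : ℝ × ℝ → ℝ × ℝ) := Measure.measurePreserving_swap
    have h2 := h0.comp h1
    convert h2 using 1
    ext p j
    fin_cases j <;> simp [planePt, b2_apply]

lemma continuous_planePt (i : Fin 2) : Continuous fun p : ℝ × ℝ => planePt i p.1 p.2 := by
  unfold planePt; fun_prop

lemma mem_ball_of_abs_le_one {x : E2} (hx : ∀ i, |x i| ≤ 1) : x ∈ closedBall (0 : E2) 2 := by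
  rw [mem_closedBall_zero_iff, EuclideanSpace.norm_eq, Real.sqrt_le_left (by norm_num)]
  rw [Fin.sum_univ_two]
  simp only [Real.norm_eq_abs]
  nlinarith [hx 0, hx 1, abs_nonneg (x 0), abs_nonneg (x 1)]

lemma forall_fin_two_iff (i : Fin 2) {P : Fin 2 → Prop} : (∀ j, P j) ↔ P i ∧ P (i + 1) := by
  fin_cases i
  · exact Fin.forall_fin_two
  · exact Fin.forall_fin_two.trans and_comm

/-- Fubini's theorem on the unit square. -/
lemma integral_lines_le {e : E2 → ℝ} (he : Continuous e) (he0 : ∀ x, 0 ≤ e x) (i : Fin 2) :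
    ∫ t in Set.Icc (-1 : ℝ) 1, ∫ s in Set.Icc (-1 : ℝ) 1, e (planePt i t s) ≤
      ∫ x in ball (0 : E2) 3, e x := by
  have hc : Continuous fun p : ℝ × ℝ => e (planePt i p.1 p.2) := he.comp (continuous_planePt i)
  have hQm : MeasurableSet {x : E2 | ∀ i, |x i| ≤ 1} := by
    have : {x : E2 | ∀ i, |x i| ≤ 1} = ⋂ i, {x : E2 | |x i| ≤ 1} := by ext; simp
    rw [this]
    exact MeasurableSet.iInter fun i => (isClosed_le (by fun_prop) continuous_const).measurableSet
  have h1 : ∫ t in Set.Icc (-1 : ℝ) 1, ∫ s in Set.Icc (-1 : ℝ) 1, e (planePt i t s) =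
      ∫ p in Set.Icc (-1 : ℝ) 1 ×ˢ Set.Icc (-1 : ℝ) 1, e (planePt i p.1 p.2) :=
    (setIntegral_prod (fun p : ℝ × ℝ => e (planePt i p.1 p.2))
      (hc.continuousOn.integrableOn_compact (isCompact_Icc.prod isCompact_Icc))).symm
  have h2 : ∫ x in {x : E2 | ∀ i, |x i| ≤ 1}, e x =
      ∫ p in Set.Icc (-1 : ℝ) 1 ×ˢ Set.Icc (-1 : ℝ) 1, e (planePt i p.1 p.2) := by
    have hm := measurePreserving_planePt i
    rw [← integral_indicator hQm, ← integral_indicator (measurableSet_Icc.prod measurableSet_Icc)]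
    conv_lhs => rw [← hm.map_eq]
    rw [integral_map hm.aemeasurable
      ((he.stronglyMeasurable.indicator hQm).aestronglyMeasurable)]
    refine integral_congr_ae (Filter.Eventually.of_forall fun p => ?_)
    have : planePt i p.1 p.2 ∈ {x : E2 | ∀ i, |x i| ≤ 1} ↔
        p ∈ Set.Icc (-1 : ℝ) 1 ×ˢ Set.Icc (-1 : ℝ) 1 := by
      rw [Set.mem_ofPred_eq, forall_fin_two_iff i, planePt_apply_self, planePt_apply_succ,
        Set.mem_prod, Set.mem_Icc, Set.mem_Icc, abs_le, abs_le]
    by_cases hp : p ∈ Set.Icc (-1 : ℝ) 1 ×ˢ Set.Icc (-1 : ℝ) 1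
    · simp only [Set.indicator_of_mem hp, Set.indicator_of_mem (this.2 hp)]
    · simp only [Set.indicator_of_notMem hp, Set.indicator_of_notMem (mt this.1 hp)]
  rw [h1, ← h2]
  refine setIntegral_mono_set ((he.continuousOn.integrableOn_compact
    (isCompact_closedBall (0 : E2) 3)).mono_set ball_subset_closedBall)
    (Filter.Eventually.of_forall he0) (LE.le.eventuallyLE fun x hx => ?_)
  exact closedBall_subset_ball (by norm_num) (mem_ball_of_abs_le_one hx)

variable {k : ℕ} {V : Evec k → ℝ}

/-- For solutions with small energy there are cut-off functions whose gradient lives where the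
potential is small. -/
lemma IsMultiWell.exists_good_cutoff (hV : IsMultiWell V) {δ : ℝ} (hδ : 0 < δ) (hδ1 : δ < 1) :
    ∃ η > (0 : ℝ), ∀ ε > (0 : ℝ), ε ≤ 1 → ∀ u : E2 → Evec k, ContDiff ℝ (⊤ : ℕ∞) u →
      ∫ x in ball (0 : E2) 3, eDens V ε u x ≤ η →
      ∃ φ : E2 → ℝ, ContDiff ℝ 1 φ ∧ HasCompactSupport φ ∧ (∀ x, 0 ≤ φ x) ∧ (∀ x, φ x ≤ 1) ∧
        (∀ x, φ x ≠ 0 → ∀ i, |x i| ≤ 1) ∧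
        (∀ x, (∀ i, |x i| ≤ 3 / 4) → 1 / 1024 ^ 2 ≤ φ x) ∧
        (∀ x i, |fderiv ℝ φ x (b2 i)| ≤ 2) ∧
        ∀ x i, fderiv ℝ φ x (b2 i) ≠ 0 → (∀ i, |x i| ≤ 1) ∧ V (u x) ≤ δ := by
  obtain ⟨C, hC, hgrad⟩ := hV.exists_gradient_sq_le
  set lam := δ / (2 + 2 * C) with hlamdef
  have hlam : 0 < lam := by positivity
  refine ⟨lam / 32, by positivity, fun ε hε hε1 u hu hE => ?_⟩
  have he : Continuous (eDens V ε u) := continuous_eDens hV.smooth hu ε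
  have he0 : ∀ x, 0 ≤ eDens V ε u x := eDens_nonneg hV.nonneg hε u
  set l : Fin 2 → ℝ → ℝ := fun i t => ∫ s in Set.Icc (-1 : ℝ) 1, eDens V ε u (planePt i t s)
    with hldef
  have hl : ∀ i, Continuous (l i) := by
    intro i
    have h1 : Continuous fun t : ℝ => ∫ s in (-1 : ℝ)..1, eDens V ε u (planePt i t s) :=
      intervalIntegral.continuous_parametric_intervalIntegral_of_continuous'
        (f := fun t s => eDens V ε u (planePt i t s)) (he.comp (continuous_planePt i)) _ _
    simp only [hldef]
    simp_rw [integral_Icc_eq_integral_Ioc]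
    simp_rw [intervalIntegral.integral_of_le (show (-1 : ℝ) ≤ 1 by norm_num)] at h1
    exact h1
  have hl0 : ∀ i t, 0 ≤ l i t := fun i t => integral_nonneg fun s => he0 _
  have hlint : ∀ i, ∫ t in Set.Icc (-1 : ℝ) 1, l i t ≤ lam / 32 := fun i =>
    (integral_lines_le he he0 i).trans hE
  choose A hA hA0 hA1 hAs hAlow hAd hAg using
    fun i => exists_good_bump (hl i) (hl0 i) hlam (hlint i)
  have hx : ∀ i : Fin 2, ContDiff ℝ 1 fun x : E2 => x i := fun i => by fun_prop
  have hφ : ContDiff ℝ 1 fun x : E2 => A 0 (x 0) * A 1 (x 1) :=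
    ((hA 0).comp (hx 0)).mul ((hA 1).comp (hx 1))
  have hsupp : ∀ x : E2, A 0 (x 0) * A 1 (x 1) ≠ 0 → ∀ i, |x i| ≤ 1 := fun x hx =>
    Fin.forall_fin_two.2 ⟨hAs 0 _ (left_ne_zero_of_mul hx), hAs 1 _ (right_ne_zero_of_mul hx)⟩
  have hfd : ∀ (x : E2) i, fderiv ℝ (fun x : E2 => A 0 (x 0) * A 1 (x 1)) x (b2 i) =
      deriv (A i) (x i) * A (i + 1) (x (i + 1)) := by
    intro x i
    refine fderiv_apply_eq_of_hasDerivAt_line (hφ.differentiable (by simp)) ?_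
    have hd : ∀ j, HasDerivAt (fun t : ℝ => A j ((x + t • b2 i) j))
        (deriv (A j) (x j) * (if j = i then 1 else 0)) 0 := by
      intro j
      have h1 : HasDerivAt (fun t : ℝ => (x + t • b2 i) j) (if j = i then 1 else 0) 0 := by
        have := ((hasDerivAt_id (0 : ℝ)).mul_const (if j = i then (1 : ℝ) else 0)).const_add (x j)
        refine (this.congr_deriv (one_mul _)).congr_of_eventuallyEq
          (Filter.Eventually.of_forall fun t => ?_)
        simp [b2_apply]
      have h2 : HasDerivAt (A j) (deriv (A j) (x j)) ((x + (0 : ℝ) • b2 i) j) := by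
        simpa using ((hA j).differentiable (by simp) (x j)).hasDerivAt
      exact h2.comp (0 : ℝ) h1
    refine ((hd 0).mul (hd 1)).congr_deriv ?_
    fin_cases i <;> simp [mul_comm]
  refine ⟨fun x => A 0 (x 0) * A 1 (x 1), hφ, ?_, fun x => mul_nonneg (hA0 _ _) (hA0 _ _),
    fun x => mul_le_one₀ (hA1 _ _) (hA0 _ _) (hA1 _ _), hsupp, ?_, ?_, ?_⟩
  · exact HasCompactSupport.intro (isCompact_closedBall (0 : E2) 2) fun x hx =>
      by_contra fun h => hx (mem_ball_of_abs_le_one (hsupp x h))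
  · intro x hx
    have h1 := hAlow 0 _ (hx 0)
    have h2 := hAlow 1 _ (hx 1)
    calc (1 / 1024 ^ 2 : ℝ) = 1 / 1024 * (1 / 1024) := by norm_num
      _ ≤ _ := mul_le_mul h1 h2 (by norm_num) (hA0 _ _)
  · intro x i
    rw [hfd, abs_mul, abs_of_nonneg (hA0 _ _)]
    nlinarith [hAd i (x i), hA1 (i + 1) (x (i + 1)), hA0 (i + 1) (x (i + 1)),
      abs_nonneg (deriv (A i) (x i))]
  · intro x i hne
    rw [hfd] at hne
    obtain ⟨hx1, hxl⟩ := hAg i _ (left_ne_zero_of_mul hne)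
    have hx2 := hAs (i + 1) _ (right_ne_zero_of_mul hne)
    refine ⟨(forall_fin_two_iff i).2 ⟨hx1, hx2⟩, ?_⟩
    have hV0 := hV.nonneg
    have hVu : ContDiff ℝ 1 fun x => V (u x) := (hV.smooth.comp hu).of_le (by simp)
    have hline : ContDiff ℝ 1 fun s : ℝ => x i • b2 i + s • b2 (i + 1) := by fun_prop
    have hd : ∀ s, deriv (fun s => V (u (planePt i (x i) s))) s =
        ⟪gradient V (u (planePt i (x i) s)), pder u (i + 1) (planePt i (x i) s)⟫ := by
      intro s
      have := (hasDerivAt_line (hVu.differentiable (by simp)) (x i • b2 i) (b2 (i + 1)) s).deriv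
      change deriv (fun s => V (u (planePt i (x i) s))) s =
        fderiv ℝ (fun x => V (u x)) (planePt i (x i) s) (b2 (i + 1)) at this
      rw [this]
      have hcomp := fderiv_comp (planePt i (x i) s) (hV.smooth.differentiable (by simp) _)
        (hu.differentiable (by simp) (planePt i (x i) s))
      change fderiv ℝ (fun x => V (u x)) (planePt i (x i) s) = _ at hcomp
      rw [hcomp]
      simp [fderiv_eq_inner_gradient, pder, -inner_gradient_left]
    have key := le_of_deriv_le_of_integral_lt (f := fun s => V (u (planePt i (x i) s)))
      (g := fun s => eDens V ε u (planePt i (x i) s)) (C := C) (lam := lam) (δ := δ)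
      (hVu.comp hline) (he.comp hline.continuous) (fun s => hV0 _) (fun s => ?_) hC.le ?_ hxl
      (by rw [hlamdef]; field_simp; exact le_rfl) hδ1 (t := x (i + 1)) (abs_le.1 hx2)
    · simpa only [planePt_eta] using key
    · have h1 := gradSq_nonneg u (planePt i (x i) s)
      have h2 := hV0 (u (planePt i (x i) s))
      have h3 : 1 ≤ ε⁻¹ := (one_le_inv₀ hε).2 hε1
      have h4 : 0 ≤ ε / 2 * gradSq u (planePt i (x i) s) := by positivity
      simp only [eDens]
      nlinarith
    · intro s hs
      rw [hd]
      set y := planePt i (x i) s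
      refine (abs_real_inner_le_norm _ _).trans ?_
      have h1 := hgrad (u y) hs
      have hi : ‖pder u (i + 1) y‖ ^ 2 ≤ gradSq u y :=
        Finset.single_le_sum (f := fun i => ‖pder u i y‖ ^ 2) (fun _ _ => by positivity)
          (Finset.mem_univ _)
      have h3 : ε / 2 * ‖pder u (i + 1) y‖ ^ 2 + ε⁻¹ * V (u y) ≤ eDens V ε u y := by
        unfold eDens; gcongr
      refine le_trans ?_ (mul_le_mul_of_nonneg_left h3 hC.le)
      set P := ‖pder u (i + 1) y‖
      set Q := ‖gradient V (u y)‖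
      have hQ : Q ^ 2 / C ^ 2 ≤ V (u y) := by
        rw [div_le_iff₀ (by positivity)]; linarith
      have h4 : ε⁻¹ * (Q ^ 2 / C ^ 2) ≤ ε⁻¹ * V (u y) := by gcongr
      have h5 : Q * P ≤ C * (ε / 2 * P ^ 2 + ε⁻¹ * (Q ^ 2 / C ^ 2)) := by
        have h6 : C * (ε / 2 * P ^ 2 + ε⁻¹ * (Q ^ 2 / C ^ 2)) - Q * P =
            (C * ε / 4) * (P - 2 * Q / (C * ε)) ^ 2 + C * ε / 4 * P ^ 2 := by
          field_simp; ring
        have h7 : 0 ≤ (C * ε / 4) * (P - 2 * Q / (C * ε)) ^ 2 + C * ε / 4 * P ^ 2 := by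
          positivity
        linarith
      refine h5.trans ?_
      gcongr

end GoodCutoff

section Pointwise

variable {k : ℕ} {V : Evec k → ℝ} {u : E2 → Evec k} {ε : ℝ}

lemma IsMultiWell.exists_sup_bound (hV : IsMultiWell V) :
    ∃ R > (0 : ℝ), ∀ ε > (0 : ℝ), ∀ u : E2 → Evec k, ContDiff ℝ (⊤ : ℕ∞) u → ∀ φ : E2 → ℝ,
      ContDiff ℝ 1 φ → HasCompactSupport φ → (∀ x, 0 ≤ φ x) →
      (∀ x, φ x ≠ 0 → lap u x = (ε ^ 2)⁻¹ • gradient V (u x)) →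
      (∀ x i, fderiv ℝ φ x (b2 i) ≠ 0 → V (u x) ≤ 1) → ∀ x, φ x ≠ 0 → ‖u x‖ ≤ R := by
  obtain ⟨α, hα, R₁, hR₁, hgrow⟩ := hV.growth
  obtain ⟨R₂, hR₂, hsub⟩ := hV.exists_sublevel_bound
  set R := max R₁ R₂ with hR
  have hR0 : 0 < R := lt_max_of_lt_left hR₁
  refine ⟨R, hR0, fun ε hε u hu φ hφ hc hφ0 hsol hgood x hx => ?_⟩
  set G : ℝ → ℝ := fun s => posSq (s - R ^ 2) with hG
  set G' : ℝ → ℝ := fun s => 2 * max 0 (s - R ^ 2) with hG'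
  have hGd : ∀ s, HasDerivAt G (G' s) s := by
    intro s
    have := (hasDerivAt_posSq (s - R ^ 2)).comp s ((hasDerivAt_id s).sub_const (R ^ 2))
    exact this.congr_deriv (mul_one _)
  have hGc : ContDiff ℝ 1 fun y : Evec k => G (‖y‖ ^ 2) := by
    refine contDiff_posSq.comp ?_
    exact (contDiff_norm_sq ℝ).sub contDiff_const
  have hG'c : Continuous fun y : Evec k => G' (‖y‖ ^ 2) := by fun_prop
  have hGs : ∀ y : Evec k, ‖y‖ ≤ R → G (‖y‖ ^ 2) = 0 := by
    intro y hy
    have : ‖y‖ ^ 2 ≤ R ^ 2 := by gcongr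
    simp [hG, posSq, max_eq_left (sub_nonpos.2 this)]
  have hid := integral_test_radial hu hφ hc hsol hGc (fun s _ => hGd s) 0
  have hrhs : ∀ x, ∑ i, fderiv ℝ φ x (b2 i) *
      (G (‖u x - 0‖ ^ 2) * ⟪pder u i x, u x - 0⟫) = 0 := by
    intro x
    refine Finset.sum_eq_zero fun i _ => ?_
    by_cases h : fderiv ℝ φ x (b2 i) = 0
    · rw [h, zero_mul]
    · rw [sub_zero, hGs _ ((hsub _ (hgood x i h)).trans (le_max_right _ _))]
      simp
  simp only [hrhs, integral_zero, neg_zero] at hid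
  have hcont : Continuous fun x => φ x * radialTest V ε u G G' 0 x :=
    hφ.continuous.mul (continuous_radialTest hV.smooth hu hGc.continuous hG'c)
  have hlow : ∀ x, G (‖u x‖ ^ 2) * ((ε ^ 2)⁻¹ * (α * ‖u x‖ ^ 2)) ≤
      radialTest V ε u G G' 0 x := by
    intro x
    have hG0 : 0 ≤ G (‖u x‖ ^ 2) := by simp only [hG, posSq]; positivity
    have hG'0 : 0 ≤ G' (‖u x‖ ^ 2) := by simp only [hG']; positivity
    have h1 : 0 ≤ ∑ i, (G (‖u x‖ ^ 2) * ‖pder u i x‖ ^ 2 +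
        2 * G' (‖u x‖ ^ 2) * ⟪pder u i x, u x⟫ ^ 2) :=
      Finset.sum_nonneg fun i _ => by positivity
    have h2 : G (‖u x‖ ^ 2) * ((ε ^ 2)⁻¹ * (α * ‖u x‖ ^ 2)) ≤
        G (‖u x‖ ^ 2) * ((ε ^ 2)⁻¹ * ⟪gradient V (u x), u x⟫) := by
      rcases le_or_gt ‖u x‖ R with h | h
      · rw [hGs _ h]; simp
      · have h3 := hgrow (u x) ((le_max_left _ _).trans_lt h)
        rw [real_inner_comm] at h3
        gcongr
    unfold radialTest
    simp only [sub_zero]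
    linarith
  have hnn : 0 ≤ fun x => φ x * radialTest V ε u G G' 0 x := fun x => by
    refine mul_nonneg (hφ0 x) (le_trans ?_ (hlow x))
    simp only [hG, posSq]; positivity
  have hzero : (fun x => φ x * radialTest V ε u G G' 0 x) = 0 := by
    have hInt : Integrable fun x => φ x * radialTest V ε u G G' 0 x :=
      hcont.integrable_of_hasCompactSupport hc.mul_right
    exact hcont.ae_eq_iff_eq volume continuous_const |>.1
      ((integral_eq_zero_iff_of_nonneg hnn hInt).1 hid)
  by_contra hcon
  rw [not_le] at hcon
  have h1 := congrFun hzero x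
  have h2 : radialTest V ε u G G' 0 x = 0 := by
    rcases mul_eq_zero.1 h1 with h | h
    · exact absurd h hx
    · exact h
  have h3 := hlow x
  rw [h2] at h3
  have h4 : 0 < ‖u x‖ ^ 2 - R ^ 2 := by
    have : R ^ 2 < ‖u x‖ ^ 2 := by gcongr
    linarith
  have h5 : 0 < G (‖u x‖ ^ 2) := by
    simp only [hG, posSq, max_eq_right h4.le]; positivity
  have h6 : 0 < ‖u x‖ := hR0.trans hcon
  have : 0 < G (‖u x‖ ^ 2) * ((ε ^ 2)⁻¹ * (α * ‖u x‖ ^ 2)) := by positivity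
  linarith

lemma deriv_deriv_nonpos_of_isLocalMax {F F₁ : ℝ → ℝ} {c t₀ : ℝ}
    (hF : ∀ t, HasDerivAt F (F₁ t) t) (hF₁ : HasDerivAt F₁ c t₀) (hmax : IsLocalMax F t₀) :
    c ≤ 0 := by
  by_contra hc
  rw [not_le] at hc
  have h1 : deriv F = F₁ := funext fun t => (hF t).deriv
  have hmin : IsLocalMin F t₀ := by
    refine isLocalMin_of_deriv_deriv_pos ?_ hmax.deriv_eq_zero (hF t₀).continuousAt
    rw [h1, hF₁.deriv]; exact hc
  have h2 : F =ᶠ[𝓝 t₀] fun _ => F t₀ := by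
    filter_upwards [hmin, hmax] with t h3 h4 using le_antisymm h4 h3
  have h3 : F₁ =ᶠ[𝓝 t₀] fun _ => 0 := by
    have := h2.deriv
    rw [h1] at this
    simpa using this
  have h4 := h3.deriv_eq
  rw [hF₁.deriv] at h4
  simp at h4
  linarith

lemma sum_pder_pder_pder (hu : ContDiff ℝ (⊤ : ℕ∞) u) (hV : ContDiff ℝ (⊤ : ℕ∞) V) {U : Set E2}
    (hU : IsOpen U) (hsol : ∀ x ∈ U, lap u x = (ε ^ 2)⁻¹ • gradient V (u x)) {y : E2}
    (hy : y ∈ U) (i : Fin 2) :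
    ∑ j, pder (pder (pder u i) j) j y =
      (ε ^ 2)⁻¹ • fderiv ℝ (gradient V) (u y) (pder u i y) := by
  have h1 : ∀ j, pder (pder (pder u i) j) j y = pder (pder (pder u j) j) i y := by
    intro j
    have h2 : pder (pder u i) j = pder (pder u j) i := funext fun x => fderiv_pder_comm hu i j x
    rw [h2]
    exact fderiv_pder_comm (contDiff_pder hu j) i j y
  simp_rw [h1]
  have h3 : ∑ j, pder (pder (pder u j) j) i y = pder (lap u) i y := by
    have hl : lap u = fun x => ∑ j, pder (pder u j) j x := rfl
    rw [hl]
    change _ = fderiv ℝ (fun x => ∑ j, pder (pder u j) j x) y (b2 i)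
    rw [fderiv_fun_sum fun j _ => (contDiff_pder (contDiff_pder hu j) j).differentiable (by simp) y]
    simp [pder]
  rw [h3]
  have h4 : lap u =ᶠ[𝓝 y] fun x => (ε ^ 2)⁻¹ • gradient V (u x) := by
    filter_upwards [hU.mem_nhds hy] with x hx using hsol x hx
  have hg := contDiff_gradient hV
  have hd : DifferentiableAt ℝ (fun x => gradient V (u x)) y :=
    (hg.comp hu).differentiable (by simp) y
  unfold pder
  rw [h4.fderiv_eq, fderiv_fun_const_smul hd]
  have hcomp := fderiv_comp y (hg.differentiable (by simp) (u y)) (hu.differentiable (by simp) y)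
  change fderiv ℝ (fun x => gradient V (u x)) y = _ at hcomp
  rw [hcomp]
  simp

end Pointwise

section GradientBound

variable {k : ℕ} {V : Evec k → ℝ} {u : E2 → Evec k} {ε : ℝ}

lemma hasDerivAt_pder {v : E2 → Evec k} (hv : ContDiff ℝ (⊤ : ℕ∞) v) (y : E2) (j : Fin 2) (t : ℝ) :
    HasDerivAt (fun t : ℝ => v (y + t • b2 j)) (pder v j (y + t • b2 j)) t :=
  hasDerivAt_line (hv.differentiable (by simp)) y (b2 j) t

/-- The derivative of `gradSq` in direction `j`. -/
def gradSq₁ (u : E2 → Evec k) (j : Fin 2) (y : E2) : ℝ :=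
  ∑ i, 2 * ⟪pder u i y, pder (pder u i) j y⟫

/-- The second derivative of `gradSq` in direction `j`. -/
def gradSq₂ (u : E2 → Evec k) (j : Fin 2) (y : E2) : ℝ :=
  ∑ i, 2 * (‖pder (pder u i) j y‖ ^ 2 + ⟪pder u i y, pder (pder (pder u i) j) j y⟫)

lemma hasDerivAt_gradSq (hu : ContDiff ℝ (⊤ : ℕ∞) u) (y : E2) (j : Fin 2) (t : ℝ) :
    HasDerivAt (fun t : ℝ => gradSq u (y + t • b2 j)) (gradSq₁ u j (y + t • b2 j)) t :=
  HasDerivAt.fun_sum fun i _ => (hasDerivAt_pder (contDiff_pder hu i) y j t).norm_sq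

lemma hasDerivAt_gradSq₁ (hu : ContDiff ℝ (⊤ : ℕ∞) u) (y : E2) (j : Fin 2) (t : ℝ) :
    HasDerivAt (fun t : ℝ => gradSq₁ u j (y + t • b2 j)) (gradSq₂ u j (y + t • b2 j)) t := by
  refine HasDerivAt.fun_sum fun i _ => ?_
  have h1 := hasDerivAt_pder (contDiff_pder hu i) y j t
  have h2 := hasDerivAt_pder (contDiff_pder (contDiff_pder hu i) j) y j t
  refine ((h1.inner ℝ h2).const_mul 2).congr_deriv ?_
  rw [real_inner_self_eq_norm_sq]
  ring

lemma hasDerivAt_paraboloid (x y : E2) (j : Fin 2) (t : ℝ) :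
    HasDerivAt (fun t : ℝ => 1 / 16 - ‖y + t • b2 j - x‖ ^ 2)
      (-(2 * ((y + t • b2 j) j - x j))) t := by
  have h1 : HasDerivAt (fun t : ℝ => y + t • b2 j - x) (b2 j) t := by
    simpa using (((hasDerivAt_id t).smul_const (b2 j)).const_add y).sub_const x
  refine (h1.norm_sq.const_sub (1 / 16)).congr_deriv ?_
  simp only [b2, EuclideanSpace.inner_single_right, PiLp.sub_apply]
  simp

lemma hasDerivAt_coord (x y : E2) (j : Fin 2) (t : ℝ) :
    HasDerivAt (fun t : ℝ => -(2 * ((y + t • b2 j) j - x j))) (-2) t := by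
  have : HasDerivAt (fun t : ℝ => -(2 * (y j + t - x j))) (-2) t := by
    have := ((((hasDerivAt_id t).const_add (y j)).sub_const (x j)).const_mul 2).neg
    exact this.congr_deriv (by norm_num)
  refine this.congr_of_eventuallyEq (Filter.Eventually.of_forall fun t => ?_)
  simp [b2_apply]

/-- Interior gradient bound by Bernstein's method. -/
lemma gradSq_le_of_norm_le (hu : ContDiff ℝ (⊤ : ℕ∞) u) (hV : ContDiff ℝ (⊤ : ℕ∞) V)
    (hε : 0 < ε) (hε1 : ε ≤ 1) {R K : ℝ} (hR : 0 < R) (hK : 0 < K)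
    (hVK : ∀ y, ‖y‖ ≤ R → ‖gradient V y‖ ≤ K ∧
      ∀ v, -(K * ‖v‖ ^ 2) ≤ ⟪fderiv ℝ (gradient V) y v, v⟫)
    {x : E2} (huR : ∀ y ∈ closedBall x (1 / 4), ‖u y‖ ≤ R)
    (hsol : ∀ y ∈ ball x (1 / 4), lap u y = (ε ^ 2)⁻¹ • gradient V (u y)) :
    ε ^ 2 * gradSq u x ≤ 2 * (K + 2) * R * K + 256 * (K + 2) * R ^ 2 := by
  set A := K + 2 with hA
  set z : E2 → ℝ := fun y => 1 / 16 - ‖y - x‖ ^ 2 with hz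
  set f : E2 → ℝ := fun y => ε ^ 2 * (z y ^ 2 * gradSq u y) + A * ‖u y‖ ^ 2 with hf
  have hzc : Continuous z := by fun_prop
  have hfc : Continuous f := by
    have h1 := continuous_gradSq hu
    have h2 := hu.continuous
    fun_prop
  obtain ⟨y, hy, hmax⟩ := (isCompact_closedBall x (1 / 4)).exists_isMaxOn
    ⟨x, mem_closedBall_self (by norm_num)⟩ hfc.continuousOn
  have hx : f x ≤ f y := hmax (mem_closedBall_self (by norm_num))
  have hzx : z x = 1 / 16 := by simp [hz]
  have hfx : ε ^ 2 * gradSq u x ≤ 256 * f x := by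
    have : 0 ≤ A * ‖u x‖ ^ 2 := by positivity
    simp only [hf, hzx]
    linarith
  have huy : ‖u y‖ ^ 2 ≤ R ^ 2 := by
    have := huR y hy
    gcongr
  have hg0 := gradSq_nonneg u y
  have hA0 : 0 < A := by linarith
  have hAu : A * ‖u y‖ ^ 2 ≤ A * R ^ 2 := by gcongr
  rcases (mem_closedBall.1 hy).lt_or_eq with hyb | hyb
  swap
  · have hzy : z y = 0 := by
      rw [dist_eq_norm] at hyb
      simp only [hz, hyb]; norm_num
    have hfy : f y = A * ‖u y‖ ^ 2 := by simp [hf, hzy]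
    have : 0 ≤ 2 * A * R * K := by positivity
    linarith
  have hyn : ‖y - x‖ ^ 2 < 1 / 16 := by
    rw [dist_eq_norm] at hyb
    nlinarith [norm_nonneg (y - x)]
  have hzy0 : 0 ≤ z y := by simp only [hz]; linarith
  have hzy1 : z y ≤ 1 / 16 := by simp only [hz]; nlinarith [sq_nonneg ‖y - x‖]
  -- second derivatives at the maximum point
  have hloc : ∀ j, IsLocalMax (fun t : ℝ => f (y + t • b2 j)) 0 := by
    intro j
    have h1 : ContinuousAt (fun t : ℝ => y + t • b2 j) 0 := by fun_prop
    have h2 : ∀ᶠ w in 𝓝 (y + (0 : ℝ) • b2 j), f w ≤ f y := by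
      rw [zero_smul, add_zero]
      filter_upwards [isOpen_ball.mem_nhds (mem_ball.2 hyb)] with w hw
      exact hmax (ball_subset_closedBall hw)
    have h3 := h1.eventually h2
    simpa [IsLocalMax, IsMaxFilter] using h3
  have hsec : ∀ j, ε ^ 2 * ((8 * (y j - x j) ^ 2 - 4 * z y) * gradSq u y -
      8 * z y * (y j - x j) * gradSq₁ u j y + z y ^ 2 * gradSq₂ u j y) +
      A * (2 * (‖pder u j y‖ ^ 2 + ⟪u y, pder (pder u j) j y⟫)) ≤ 0 := by
    intro j
    have hd1 : ∀ t : ℝ, HasDerivAt (fun t : ℝ => f (y + t • b2 j))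
        (ε ^ 2 * (2 * z (y + t • b2 j) * (-(2 * ((y + t • b2 j) j - x j))) *
          gradSq u (y + t • b2 j) + z (y + t • b2 j) ^ 2 * gradSq₁ u j (y + t • b2 j)) +
          A * (2 * ⟪u (y + t • b2 j), pder u j (y + t • b2 j)⟫)) t := by
      intro t
      have h1 := hasDerivAt_paraboloid x y j t
      have h2 := hasDerivAt_gradSq hu y j t
      have h3 := (hasDerivAt_pder hu y j t).norm_sq
      refine ((((h1.pow 2).mul h2).const_mul (ε ^ 2)).add (h3.const_mul A)).congr_deriv ?_
      simp only [hz, Pi.pow_apply]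
      push_cast
      ring
    refine deriv_deriv_nonpos_of_isLocalMax hd1 ?_ (hloc j)
    have h1 := hasDerivAt_paraboloid x y j 0
    have h2 := hasDerivAt_gradSq hu y j 0
    have h3 := hasDerivAt_pder hu y j 0
    have h4 := hasDerivAt_pder (contDiff_pder hu j) y j 0
    have h5 := hasDerivAt_coord x y j 0
    have h6 := hasDerivAt_gradSq₁ hu y j 0
    refine ((((((h1.const_mul 2).mul h5).mul h2).add ((h1.pow 2).mul h6)).const_mul
      (ε ^ 2)).add (((h3.inner ℝ h4).const_mul 2).const_mul A)).congr_deriv ?_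
    simp only [Pi.pow_apply, Pi.mul_apply, zero_smul, add_zero, real_inner_self_eq_norm_sq, hz]
    push_cast
    ring
  have hcross : ∀ i j, 0 ≤ 2 * z y ^ 2 * ‖pder (pder u i) j y‖ ^ 2 +
      32 * (y j - x j) ^ 2 * ‖pder u i y‖ ^ 2 -
      16 * z y * (y j - x j) * ⟪pder u i y, pder (pder u i) j y⟫ := by
    intro i j
    have h := norm_sub_sq_real (z y • pder (pder u i) j y) ((4 * (y j - x j)) • pder u i y)
    rw [norm_smul, norm_smul, mul_pow, mul_pow, Real.norm_eq_abs, Real.norm_eq_abs, sq_abs, sq_abs,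
      real_inner_smul_left, real_inner_smul_right, real_inner_comm] at h
    nlinarith [sq_nonneg ‖z y • pder (pder u i) j y - (4 * (y j - x j)) • pder u i y‖]
  have huyR : ‖u y‖ ≤ R := huR y hy
  have hthird : ∀ i, -((ε ^ 2)⁻¹ * (K * ‖pder u i y‖ ^ 2)) ≤
      ⟪pder u i y, pder (pder (pder u i) 0) 0 y⟫ + ⟪pder u i y, pder (pder (pder u i) 1) 1 y⟫ := by
    intro i
    have h := sum_pder_pder_pder hu hV isOpen_ball hsol (mem_ball.2 hyb) i
    rw [Fin.sum_univ_two] at h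
    rw [← inner_add_right, h, real_inner_smul_right, real_inner_comm]
    have h2 := mul_le_mul_of_nonneg_left ((hVK _ huyR).2 (pder u i y))
      (by positivity : 0 ≤ (ε ^ 2)⁻¹)
    linarith
  have hlap : -((ε ^ 2)⁻¹ * (R * K)) ≤
      ⟪u y, pder (pder u 0) 0 y⟫ + ⟪u y, pder (pder u 1) 1 y⟫ := by
    have h := hsol y (mem_ball.2 hyb)
    rw [lap, Fin.sum_univ_two] at h
    change pder (pder u 0) 0 y + pder (pder u 1) 1 y = _ at h
    rw [← inner_add_right, h, real_inner_smul_right]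
    have h1 : |⟪u y, gradient V (u y)⟫| ≤ R * K :=
      (abs_real_inner_le_norm _ _).trans
        (mul_le_mul huyR (hVK _ huyR).1 (norm_nonneg _) hR.le)
    have h2 := mul_le_mul_of_nonneg_left (neg_le_of_abs_le h1) (by positivity : 0 ≤ (ε ^ 2)⁻¹)
    linarith
  have hD : (y 0 - x 0) ^ 2 + (y 1 - x 1) ^ 2 = ‖y - x‖ ^ 2 := by
    rw [EuclideanSpace.norm_sq_eq, Fin.sum_univ_two]
    simp
  have hs0 := hsec 0
  have hs1 := hsec 1
  have hc00 := hcross 0 0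
  have hc01 := hcross 0 1
  have hc10 := hcross 1 0
  have hc11 := hcross 1 1
  have ht0 := hthird 0
  have ht1 := hthird 1
  have hzD : z y = 1 / 16 - ‖y - x‖ ^ 2 := rfl
  have he : 0 < ε ^ 2 := by positivity
  have he1 : ε ^ 2 ≤ 1 := pow_le_one₀ hε.le hε1
  have heq : ε ^ 2 * (ε ^ 2)⁻¹ = 1 := mul_inv_cancel₀ he.ne'
  have hg : gradSq u y = ‖pder u 0 y‖ ^ 2 + ‖pder u 1 y‖ ^ 2 := by simp [gradSq]
  simp only [gradSq₁, gradSq₂, Fin.sum_univ_two] at hs0 hs1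
  have hkey : ε ^ 2 * (-(3 / 2) * gradSq u y - 2 * z y ^ 2 * ((ε ^ 2)⁻¹ * (K * gradSq u y))) +
      2 * A * (gradSq u y - (ε ^ 2)⁻¹ * (R * K)) ≤ 0 := by
    have hm := mul_le_mul_of_nonneg_left (add_le_add ht0 ht1)
      (by positivity : 0 ≤ ε ^ 2 * (2 * z y ^ 2))
    have hc := mul_nonneg he.le (add_nonneg (add_nonneg hc00 hc01) (add_nonneg hc10 hc11))
    have hl := mul_le_mul_of_nonneg_left hlap (by positivity : 0 ≤ 2 * A)
    have hDg : 0 ≤ ε ^ 2 * ((1 / 16 - ‖y - x‖ ^ 2) * gradSq u y) :=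
      mul_nonneg he.le (mul_nonneg (by linarith) hg0)
    have hzg : ε ^ 2 * (z y * gradSq u y) = ε ^ 2 * ((1 / 16 - ‖y - x‖ ^ 2) * gradSq u y) := by
      rw [hzD]
    have hDg2 : ε ^ 2 * (((y 0 - x 0) ^ 2 + (y 1 - x 1) ^ 2) * gradSq u y) =
      ε ^ 2 * (‖y - x‖ ^ 2 * gradSq u y) := by rw [hD]
    rw [hg] at hDg hzg hDg2 hs0 hs1 ⊢
    linarith
  have hcancel : ε ^ 2 * (z y ^ 2 * ((ε ^ 2)⁻¹ * (K * gradSq u y))) =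
      z y ^ 2 * (K * gradSq u y) := by
    rw [mul_left_comm, mul_inv_cancel_left₀ he.ne']
  have hz2 : z y ^ 2 ≤ 1 / 256 :=
    (pow_le_pow_left₀ hzy0 hzy1 2).trans (by norm_num)
  have hzK : z y ^ 2 * (K * gradSq u y) ≤ 1 / 256 * (K * gradSq u y) := by gcongr
  have hegr : ε ^ 2 * gradSq u y ≤ gradSq u y := mul_le_of_le_one_left hg0 he1
  have hgy : gradSq u y ≤ 2 * A * ((ε ^ 2)⁻¹ * (R * K)) := by
    have : A * gradSq u y = K * gradSq u y + 2 * gradSq u y := by rw [hA]; ring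
    have hKg : 0 ≤ K * gradSq u y := by positivity
    linarith
  have hfy : ε ^ 2 * (z y ^ 2 * gradSq u y) ≤ 1 / 256 * (2 * A * (R * K)) := by
    have h1 := mul_le_mul_of_nonneg_left hgy he.le
    have h2 : ε ^ 2 * (2 * A * ((ε ^ 2)⁻¹ * (R * K))) = 2 * A * (R * K) := by
      rw [mul_left_comm, mul_inv_cancel_left₀ he.ne']
    have h3 : z y ^ 2 * (ε ^ 2 * gradSq u y) ≤ 1 / 256 * (ε ^ 2 * gradSq u y) := by gcongr
    linarith
  have hff : f y = ε ^ 2 * (z y ^ 2 * gradSq u y) + A * ‖u y‖ ^ 2 := rfl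
  linarith

end GradientBound

section EnergyByPotential

variable {k : ℕ} {V : Evec k → ℝ} {u : E2 → Evec k} {ε a Λ : ℝ} {σ : Evec k}

/-- The radially tested density for `wellCutoff`, corrected by a multiple of the potential so as to
be nonnegative. -/
def wellDensity (V : Evec k → ℝ) (ε : ℝ) (u : E2 → Evec k) (a Λ : ℝ) (σ : Evec k) (x : E2) : ℝ :=
  ε * radialTest V ε u (wellCutoff a) (wellCutoff' a) σ x + Λ * (ε⁻¹ * V (u x))

lemma mul_gradSq_le_of_le_potential (hε : 0 < ε) {C b : ℝ} (hC : 0 < C) (hb : 0 < b) {x : E2}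
    (hg : ε ^ 2 * gradSq u x ≤ C) (hVb : b ≤ V (u x)) :
    ε * gradSq u x ≤ C / b * (ε⁻¹ * V (u x)) := by
  have h1 : ε * gradSq u x = ε⁻¹ * (ε ^ 2 * gradSq u x) := by field_simp
  have h2 : C ≤ C / b * V (u x) := by
    rw [div_mul_eq_mul_div, le_div_iff₀ hb]
    gcongr
  rw [h1, mul_left_comm (C / b)]
  exact mul_le_mul_of_nonneg_left (hg.trans h2) (by positivity)

lemma wellDensity_nonneg_and_le (hV0 : ∀ y, 0 ≤ V y) (hε : 0 < ε) (ha : 0 < a)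
    (hwell : ∀ y, ‖y - σ‖ ≤ a → a * ‖y - σ‖ ^ 2 ≤ ⟪gradient V y, y - σ⟫ ∧ a * ‖y - σ‖ ^ 2 ≤ V y)
    {C b : ℝ} (hC : 0 < C) (hb : 0 < b) (hba : b ≤ a ^ 3 / 10) {x : E2}
    (hg : ε ^ 2 * gradSq u x ≤ C) :
    0 ≤ wellDensity V ε u a (C / b) σ x ∧
      (‖u x - σ‖ ^ 2 ≤ a ^ 2 / 10 →
        1 / 4 * (ε * gradSq u x) ≤ wellDensity V ε u a (C / b) σ x) := by
  have hVx := hV0 (u x)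
  have hg0 := gradSq_nonneg u x
  have hP : 0 ≤ C / b * (ε⁻¹ * V (u x)) := by positivity
  have hEg : 0 ≤ ε * gradSq u x := by positivity
  rcases le_or_gt a (‖u x - σ‖) with hd | hd
  · have hs : a ^ 2 ≤ ‖u x - σ‖ ^ 2 := by gcongr
    have : wellDensity V ε u a (C / b) σ x = C / b * (ε⁻¹ * V (u x)) := by
      simp [wellDensity, radialTest, wellCutoff_eq_zero ha hs, wellCutoff'_eq_zero ha hs]
    rw [this]
    refine ⟨hP, fun h => ?_⟩
    have : 0 < a ^ 2 := by positivity
    linarith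
  obtain ⟨hw1, hw2⟩ := hwell (u x) hd.le
  have hq := Finset.sum_le_sum fun i (_ : i ∈ Finset.univ) =>
    wellCutoff_quadratic ha (pder u i x) (u x - σ) hd
  rw [← Finset.mul_sum] at hq
  change _ * gradSq u x ≤ _ at hq
  set d := ‖u x - σ‖ with hdd
  have hG : 0 ≤ wellCutoff a (d ^ 2) * ((ε ^ 2)⁻¹ * ⟪gradient V (u x), u x - σ⟫) :=
    mul_nonneg (wellCutoff_nonneg _ _) (mul_nonneg (by positivity)
      (le_trans (by positivity) hw1))
  have hlow : (1 - d ^ 2 / a ^ 2) * (1 - 5 * (d ^ 2 / a ^ 2)) * (ε * gradSq u x) +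
      C / b * (ε⁻¹ * V (u x)) ≤ wellDensity V ε u a (C / b) σ x := by
    have h := mul_le_mul_of_nonneg_left (add_le_add hG hq) hε.le
    unfold wellDensity radialTest
    linarith
  rcases le_or_gt (d ^ 2) (a ^ 2 / 10) with hz | hz
  · have hz1 : d ^ 2 / a ^ 2 ≤ 1 / 10 := by
      rw [div_le_iff₀ (by positivity)]; linarith
    have hz0 : 0 ≤ d ^ 2 / a ^ 2 := by positivity
    have hco : 1 / 4 ≤ (1 - d ^ 2 / a ^ 2) * (1 - 5 * (d ^ 2 / a ^ 2)) := by nlinarith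
    have := mul_le_mul_of_nonneg_right hco hEg
    exact ⟨by linarith, fun _ => by linarith⟩
  · have hco : -1 ≤ (1 - d ^ 2 / a ^ 2) * (1 - 5 * (d ^ 2 / a ^ 2)) := by
      nlinarith [sq_nonneg (d ^ 2 / a ^ 2 - 3 / 5)]
    have hVb : b ≤ V (u x) := by
      refine hba.trans (le_trans ?_ hw2)
      nlinarith
    have h1 := mul_gradSq_le_of_le_potential hε hC hb hg hVb
    have := mul_le_mul_of_nonneg_right hco hEg
    exact ⟨by linarith, fun h => absurd h (not_le.2 hz)⟩

lemma continuous_wellDensity (hV : ContDiff ℝ (⊤ : ℕ∞) V) (hu : ContDiff ℝ (⊤ : ℕ∞) u) :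
    Continuous (wellDensity V ε u a Λ σ) := by
  have h1 : Continuous fun y : Evec k => wellCutoff a (‖y‖ ^ 2) :=
    (contDiff_wellCutoff a).continuous.comp (by fun_prop)
  have h2 : Continuous fun y : Evec k => wellCutoff' a (‖y‖ ^ 2) :=
    (continuous_wellCutoff' a).comp (by fun_prop)
  have h3 := hV.continuous.comp hu.continuous
  exact (continuous_const.mul (continuous_radialTest hV hu h1 h2)).add
    (continuous_const.mul (continuous_const.mul h3))

/-- Where the gradient is controlled, the energy is controlled by the potential part. -/
lemma IsMultiWell.exists_energy_le_potential (hV : IsMultiWell V) (ha : 0 < a) (ha1 : a < 1)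
    (hwell : ∀ σ, V σ = 0 → ∀ y, ‖y - σ‖ ≤ a → a * ‖y - σ‖ ^ 2 ≤ ⟪gradient V y, y - σ⟫ ∧
      ‖gradient V y‖ ≤ ‖y - σ‖ / a ∧ a * ‖y - σ‖ ^ 2 ≤ V y ∧ V y ≤ ‖y - σ‖ ^ 2 / a)
    {C : ℝ} (hC : 0 < C) :
    ∃ D > (0 : ℝ), ∀ ε > (0 : ℝ), ∀ u : E2 → Evec k, ContDiff ℝ (⊤ : ℕ∞) u →
      (∀ x ∈ ball (0 : E2) 3, lap u x = (ε ^ 2)⁻¹ • gradient V (u x)) →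
      (∀ x ∈ closedBall (0 : E2) (1 / 2), ε ^ 2 * gradSq u x ≤ C) →
        ∫ x in ball (0 : E2) (1 / 4), eDens V ε u x ≤
          D * (ε * (∫ x in ball (0 : E2) 3, eDens V ε u x) +
            ∫ x in ball (0 : E2) (1 / 2), ε⁻¹ * V (u x)) := by
  obtain ⟨θ, B, hB, hθ, hθc, hθ0, hθ1, hθin, hθout, hθB⟩ :=
    exists_cutoff (r := 1 / 4) (R := 1 / 2) (by norm_num) (by norm_num)
  obtain ⟨b₀, hb₀, -, hnear⟩ := hV.exists_near_well (κ := √(a ^ 2 / 10)) (by positivity)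
  set b := min b₀ (a ^ 3 / 10) with hbdef
  have hb : 0 < b := by positivity
  set Z := hV.finite_zeros.toFinset with hZ
  have hmem : ∀ σ, σ ∈ Z ↔ V σ = 0 := fun σ => by simp [hZ]
  have hVs := hV.smooth
  have hV0 := hV.nonneg
  set Λ := C / b with hΛ
  have hΛ0 : 0 < Λ := by positivity
  refine ⟨2 * Z.card * (2 * B / a + Λ) + (Λ / 2 + 1), by positivity, ?_⟩
  intro ε hε u hu hsol hgrad
  set E := ∫ x in ball (0 : E2) 3, eDens V ε u x with hE
  set P := ∫ x in ball (0 : E2) (1 / 2), ε⁻¹ * V (u x) with hP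
  have hE0 : 0 ≤ E := setIntegral_eDens_nonneg hV0 hε u _
  have hP0 : 0 ≤ P := integral_nonneg fun x => mul_nonneg (by positivity) (hV0 _)
  have hVc : Continuous fun x => ε⁻¹ * V (u x) :=
    continuous_const.mul (hVs.continuous.comp hu.continuous)
  have hθP : Integrable fun x => θ x * (ε⁻¹ * V (u x)) :=
    (hθ.continuous.mul hVc).integrable_of_hasCompactSupport hθc.mul_right
  have hθPle : ∫ x, θ x * (ε⁻¹ * V (u x)) ≤ P := by
    rw [hP, ← integral_indicator measurableSet_ball]
    refine integral_mono hθP (((hVc.continuousOn.integrableOn_compact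
      (isCompact_closedBall 0 (1 / 2))).mono_set ball_subset_closedBall).integrable_indicator
      measurableSet_ball) fun x => ?_
    by_cases hx : x ∈ ball (0 : E2) (1 / 2)
    · rw [Set.indicator_of_mem hx]
      exact mul_le_of_le_one_left (mul_nonneg (by positivity) (hV0 _)) (hθ1 x)
    · rw [Set.indicator_of_notMem hx]
      simp [(hθout x hx).1]
  have hθP0 : 0 ≤ ∫ x, θ x * (ε⁻¹ * V (u x)) :=
    integral_nonneg fun x => mul_nonneg (hθ0 x) (mul_nonneg (by positivity) (hV0 _))
  have hMint : ∀ σ, Integrable fun x => θ x * wellDensity V ε u a Λ σ x := fun σ =>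
    (hθ.continuous.mul (continuous_wellDensity hVs hu)).integrable_of_hasCompactSupport
      hθc.mul_right
  have hM : ∀ σ, V σ = 0 → ∀ x ∈ closedBall (0 : E2) (1 / 2),
      0 ≤ wellDensity V ε u a Λ σ x ∧ (‖u x - σ‖ ^ 2 ≤ a ^ 2 / 10 →
        1 / 4 * (ε * gradSq u x) ≤ wellDensity V ε u a Λ σ x) := fun σ hσ x hx =>
    wellDensity_nonneg_and_le hV0 hε ha
      (fun y hy => ⟨(hwell σ hσ y hy).1, (hwell σ hσ y hy).2.2.1⟩) hC hb (min_le_right _ _)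
      (hgrad x hx)
  have hME : ∀ σ, V σ = 0 → ∫ x, θ x * wellDensity V ε u a Λ σ x ≤
      (2 * B / a + Λ) * (ε * E + P) := by
    intro σ hσ
    have hcd : ContDiff ℝ 1 fun y : Evec k => wellCutoff a (‖y‖ ^ 2) :=
      (contDiff_wellCutoff a).comp (contDiff_norm_sq ℝ)
    have h1 := integral_radialTest_le (V := V) hV0 hu hε ha ha1
      (fun y hy => (hwell σ hσ y hy).2.2.1) hcd
      (fun s _ => hasDerivAt_wellCutoff a s)
      (fun s hs => by
        rw [abs_of_nonneg (wellCutoff_nonneg a s)]; exact wellCutoff_le_one a hs)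
      (fun s hs => wellCutoff_eq_zero ha hs) (hθ.of_le (by simp)) hθc
      (fun x hx => hsol x (by
        by_contra h
        exact hx (hθout x fun h' => h (ball_subset_ball (by norm_num) h')).1)) hB.le hθB
      (S := ball (0 : E2) 3) measurableSet_ball
      (fun x hx => (hθout x fun h' => hx (ball_subset_ball (by norm_num) h')).2)
      (integrableOn_eDens_ball hVs hu ε _ _)
    have h2 : ∫ x, θ x * wellDensity V ε u a Λ σ x =
        ε * (∫ x, θ x * radialTest V ε u (wellCutoff a) (wellCutoff' a) σ x) +
          Λ * ∫ x, θ x * (ε⁻¹ * V (u x)) := by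
      rw [← integral_const_mul, ← integral_const_mul, ← integral_add]
      · refine integral_congr_ae (Filter.Eventually.of_forall fun x => ?_)
        simp only [wellDensity]; ring
      · exact ((hθ.continuous.mul (continuous_radialTest hVs hu hcd.continuous
          ((continuous_wellCutoff' a).comp (by fun_prop)))).integrable_of_hasCompactSupport
          hθc.mul_right).const_mul _
      · exact hθP.const_mul _
    rw [h2]
    have h3 := mul_le_mul_of_nonneg_left h1 hε.le
    have h4 := mul_le_mul_of_nonneg_left hθPle hΛ0.le
    have h5 : 0 ≤ 2 * B / a * P := by positivity
    have h6 : 0 ≤ Λ * (ε * E) := by positivity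
    linarith
  have hpt : ∀ x, (ball (0 : E2) (1 / 4)).indicator (eDens V ε u) x ≤
      2 * ∑ σ ∈ Z, θ x * wellDensity V ε u a Λ σ x + (Λ / 2 + 1) * (θ x * (ε⁻¹ * V (u x))) := by
    intro x
    have hPx : 0 ≤ ε⁻¹ * V (u x) := mul_nonneg (by positivity) (hV0 _)
    have hnn : ∀ σ ∈ Z, 0 ≤ θ x * wellDensity V ε u a Λ σ x := by
      intro σ hσ
      by_cases hx : x ∈ ball (0 : E2) (1 / 2)
      · exact mul_nonneg (hθ0 x) (hM σ ((hmem σ).1 hσ) x (ball_subset_closedBall hx)).1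
      · simp [(hθout x hx).1]
    by_cases hx : x ∈ ball (0 : E2) (1 / 4)
    · rw [Set.indicator_of_mem hx]
      have hx2 : x ∈ closedBall (0 : E2) (1 / 2) :=
        closedBall_subset_closedBall (by norm_num) (ball_subset_closedBall hx)
      have hθx := hθin x (ball_subset_closedBall hx)
      simp only [hθx, one_mul] at hnn ⊢
      have hsum := Finset.sum_nonneg hnn
      have hkey : ε * gradSq u x ≤ 4 * ∑ σ ∈ Z, wellDensity V ε u a Λ σ x +
          Λ * (ε⁻¹ * V (u x)) := by
        rcases le_or_gt (V (u x)) b with hVb | hVb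
        · obtain ⟨σ, hσ, hd⟩ := hnear (u x) (hVb.trans (min_le_left _ _))
          have hd2 : ‖u x - σ‖ ^ 2 ≤ a ^ 2 / 10 := by
            rw [Real.lt_sqrt (norm_nonneg _)] at hd
            exact hd.le
          have h1 := (hM σ hσ x hx2).2 hd2
          have h2 := Finset.single_le_sum hnn ((hmem σ).2 hσ)
          have h3 : 0 ≤ Λ * (ε⁻¹ * V (u x)) := by positivity
          linarith
        · have h1 := mul_gradSq_le_of_le_potential hε hC hb (hgrad x hx2) hVb.le
          linarith
      unfold eDens
      linarith
    · rw [Set.indicator_of_notMem hx]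
      have := Finset.sum_nonneg hnn
      have := mul_nonneg (hθ0 x) hPx
      positivity
  have hsumint : Integrable fun x => 2 * ∑ σ ∈ Z, θ x * wellDensity V ε u a Λ σ x :=
    (integrable_finsetSum _ fun σ _ => hMint σ).const_mul _
  have h1 := integral_mono ((integrableOn_eDens_ball hVs hu ε _ _).integrable_indicator
    measurableSet_ball) (hsumint.add (hθP.const_mul (Λ / 2 + 1))) hpt
  rw [integral_indicator measurableSet_ball] at h1
  refine h1.trans ?_
  simp only [Pi.add_apply]
  rw [integral_add hsumint (hθP.const_mul _), integral_const_mul, integral_const_mul,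
    integral_finsetSum _ fun σ _ => hMint σ]
  have h2 : ∑ σ ∈ Z, ∫ x, θ x * wellDensity V ε u a Λ σ x ≤
      Z.card • ((2 * B / a + Λ) * (ε * E + P)) :=
    Finset.sum_le_card_nsmul _ _ _ fun σ hσ => hME σ ((hmem σ).1 hσ)
  rw [nsmul_eq_mul] at h2
  have h3 : (Λ / 2 + 1) * (∫ x, θ x * (ε⁻¹ * V (u x))) ≤ (Λ / 2 + 1) * (ε * E + P) := by
    have : 0 ≤ ε * E := by positivity
    gcongr
    linarith
  linarith

end EnergyByPotential

section EnergyDecay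

variable {k : ℕ} {V : Evec k → ℝ} {u : E2 → Evec k} {ε : ℝ}

/-- The density in Pohozaev's identity is controlled by the energy density. -/
lemma abs_sum_fderiv_mul_stressField_le (hV0 : ∀ y, 0 ≤ V y) (hε : 0 < ε) {φ : E2 → ℝ}
    (hφ : ∀ x i, |fderiv ℝ φ x (b2 i)| ≤ 2)
    (hφ' : ∀ x i, fderiv ℝ φ x (b2 i) ≠ 0 → ∀ i, |x i| ≤ 1) (x : E2) :
    |∑ i, fderiv ℝ φ x (b2 i) * stressField V ε u i x| ≤ 16 * eDens V ε u x := by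
  have he := eDens_nonneg hV0 hε u x
  have hi : ∀ i, |fderiv ℝ φ x (b2 i) * stressField V ε u i x| ≤ 8 * eDens V ε u x := by
    intro i
    by_cases h : fderiv ℝ φ x (b2 i) = 0
    · rw [h, zero_mul, abs_zero]; positivity
    · rw [abs_mul]
      calc _ ≤ 2 * (4 * eDens V ε u x) := mul_le_mul (hφ x i)
            (abs_stressField_le hV0 hε i (hφ' x i h)) (abs_nonneg _) (by norm_num)
        _ = _ := by ring
  refine (Finset.abs_sum_le_sum_abs _ _).trans ?_
  rw [Fin.sum_univ_two]
  linarith [hi 0, hi 1]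

/-- Solutions with small energy and small `ε` have small relative energy on a smaller disk. -/
lemma IsMultiWell.exists_energy_decay (hV : IsMultiWell V) {c : ℝ} (hc : 0 < c) :
    ∃ η > (0 : ℝ), ∃ ε₀ > (0 : ℝ), ∀ ε > (0 : ℝ), ε ≤ ε₀ → ∀ u : E2 → Evec k,
      ContDiff ℝ (⊤ : ℕ∞) u →
      (∀ x ∈ ball (0 : E2) 3, lap u x = (ε ^ 2)⁻¹ • gradient V (u x)) →
      ∫ x in ball (0 : E2) 3, eDens V ε u x ≤ η →
        ∫ x in ball (0 : E2) (1 / 4), eDens V ε u x ≤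
          c * ∫ x in ball (0 : E2) 3, eDens V ε u x := by
  have hVs := hV.smooth
  have hV0 := hV.nonneg
  obtain ⟨a, ha, ha1, hwell⟩ := hV.exists_well_bounds
  obtain ⟨C, hC, hnearzone⟩ := hV.exists_near_zone_bound ha ha1 hwell
  obtain ⟨R, hR, hsup⟩ := hV.exists_sup_bound
  obtain ⟨K, hK, hVK⟩ := hV.exists_bounds_on_ball R
  obtain ⟨D, hD, hpot⟩ := hV.exists_energy_le_potential ha ha1 hwell
    (C := 2 * (K + 2) * R * K + 256 * (K + 2) * R ^ 2) (by positivity)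
  set L := 1024 ^ 2 * (8 * C) with hL
  have hL0 : 0 < L := by positivity
  set κ := min (a / 2) (c / (2 * D * (L + 1))) with hκdef
  have hκ : 0 < κ := by positivity
  have hκa : κ ≤ a / 2 := min_le_left _ _
  have hκc : κ ≤ c / (2 * D * (L + 1)) := min_le_right _ _
  obtain ⟨δ, hδ, hδ1, hnear⟩ := hV.exists_near_well hκ
  obtain ⟨η, hη, hcut⟩ := hV.exists_good_cutoff hδ hδ1
  refine ⟨η, hη, min 1 (c / (2 * D * (L + 1))), by positivity, ?_⟩
  intro ε hε hε0 u hu hsol hEη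
  have hε1 : ε ≤ 1 := hε0.trans (min_le_left _ _)
  have hεc : ε ≤ c / (2 * D * (L + 1)) := hε0.trans (min_le_right _ _)
  obtain ⟨φ, hφ, hφc, hφ0, hφ1, hφs, hφin, hφB, hφV⟩ := hcut ε hε hε1 u hu hEη
  set E := ∫ x in ball (0 : E2) 3, eDens V ε u x with hE
  have hE0 : 0 ≤ E := setIntegral_eDens_nonneg hV0 hε u _
  have hφsol : ∀ x, φ x ≠ 0 → lap u x = (ε ^ 2)⁻¹ • gradient V (u x) := fun x hx =>
    hsol x (closedBall_subset_ball (by norm_num) (mem_ball_of_abs_le_one (hφs x hx)))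
  have hφpos : ∀ x ∈ closedBall (0 : E2) (3 / 4), 1 / 1024 ^ 2 ≤ φ x := by
    intro x hx
    refine hφin x fun i => ?_
    rw [mem_closedBall_zero_iff] at hx
    exact (PiLp.norm_apply_le x i).trans hx
  have hφne : ∀ x ∈ closedBall (0 : E2) (3 / 4), φ x ≠ 0 := fun x hx h => by
    have := hφpos x hx
    rw [h] at this
    norm_num at this
  have hVc : Continuous fun x => ε⁻¹ * V (u x) :=
    continuous_const.mul (hVs.continuous.comp hu.continuous)
  -- the potential part
  have hψ := hnearzone κ hκ hκa ε hε u hu hsol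
    (fun x => 1 / 16 * ∑ i, fderiv ℝ φ x (b2 i) * stressField V ε u i x)
    (fun x => by
      have := abs_sum_fderiv_mul_stressField_le (u := u) hV0 hε hφB
        (fun x i h => (hφV x i h).1) x
      rw [abs_mul, abs_of_pos (by norm_num : (0 : ℝ) < 1 / 16)]
      linarith)
    (fun x hx => by
      have : ∃ i, fderiv ℝ φ x (b2 i) ≠ 0 := by
        by_contra! h
        exact hx (by simp [h])
      obtain ⟨i, hi⟩ := this
      exact ⟨mem_ball_of_abs_le_one (hφV x i hi).1, hnear _ (hφV x i hi).2⟩)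
  have hpoh := integral_pohozaev hVs hu hε.ne' hφ hφc
    ⟨0, hφne 0 (mem_closedBall_self (by norm_num))⟩ hφsol
  rw [integral_const_mul, abs_mul, abs_of_pos (by norm_num : (0 : ℝ) < 1 / 16)] at hψ
  have h2 : ∫ x, φ x * (2 * (ε⁻¹ * V (u x))) = 2 * ∫ x, φ x * (ε⁻¹ * V (u x)) := by
    rw [← integral_const_mul]
    exact integral_congr_ae (Filter.Eventually.of_forall fun x => by ring)
  rw [h2] at hpoh
  have hφP : ∫ x, φ x * (ε⁻¹ * V (u x)) ≤ 8 * C * (κ + ε) * E := by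
    have := neg_abs_le (∫ x, ∑ i, fderiv ℝ φ x (b2 i) * stressField V ε u i x)
    linarith
  have hP : ∫ x in ball (0 : E2) (1 / 2), ε⁻¹ * V (u x) ≤
      1024 ^ 2 * ∫ x, φ x * (ε⁻¹ * V (u x)) := by
    rw [← integral_const_mul, ← integral_indicator measurableSet_ball]
    refine integral_mono (((hVc.continuousOn.integrableOn_compact
      (isCompact_closedBall 0 (1 / 2))).mono_set ball_subset_closedBall).integrable_indicator
      measurableSet_ball)
      (((hφ.continuous.mul hVc).integrable_of_hasCompactSupport hφc.mul_right).const_mul _)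
      fun x => ?_
    have hPx : 0 ≤ ε⁻¹ * V (u x) := mul_nonneg (by positivity) (hV0 _)
    by_cases hx : x ∈ ball (0 : E2) (1 / 2)
    · rw [Set.indicator_of_mem hx]
      have h1 := hφpos x (closedBall_subset_closedBall (by norm_num) (ball_subset_closedBall hx))
      have h3 := mul_le_mul_of_nonneg_right h1 hPx
      simp only
      linarith
    · rw [Set.indicator_of_notMem hx]
      have := mul_nonneg (hφ0 x) hPx
      positivity
  -- the gradient bound
  have hubd := hsup ε hε u hu φ hφ hφc hφ0 hφsol
    (fun x i h => (hφV x i h).2.trans hδ1.le)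
  have hgrad : ∀ x ∈ closedBall (0 : E2) (1 / 2),
      ε ^ 2 * gradSq u x ≤ 2 * (K + 2) * R * K + 256 * (K + 2) * R ^ 2 := by
    intro x hx
    have hsub : closedBall x (1 / 4) ⊆ closedBall 0 (3 / 4) :=
      closedBall_subset_closedBall' (by rw [mem_closedBall] at hx; linarith)
    exact gradSq_le_of_norm_le hu hVs hε hε1 hR hK hVK
      (fun y hy => hubd y (hφne y (hsub hy)))
      (fun y hy => hφsol y (hφne y (hsub (ball_subset_closedBall hy))))
  refine (hpot ε hε u hu hsol hgrad).trans ?_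
  have hfin : ε * E + ∫ x in ball (0 : E2) (1 / 2), ε⁻¹ * V (u x) ≤
      (L + 1) * (κ + ε) * E := by
    have : 0 ≤ κ * E := by positivity
    rw [hL]
    linarith
  have hsum : D * ((L + 1) * (κ + ε)) ≤ c := by
    have h1 : κ + ε ≤ 2 * (c / (2 * D * (L + 1))) := by linarith
    calc D * ((L + 1) * (κ + ε)) ≤ D * ((L + 1) * (2 * (c / (2 * D * (L + 1))))) := by gcongr
      _ = c := by field_simp
  calc _ ≤ D * ((L + 1) * (κ + ε) * E) := by gcongr
    _ = D * ((L + 1) * (κ + ε)) * E := by ring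
    _ ≤ c * E := by gcongr

end EnergyDecay

section Transfer

variable {k : ℕ} {V : Evec k → ℝ} {u v : E2 → Evec k} {ε s : ℝ} {x : E2}

lemma pder_comp_add_smul (hv : Differentiable ℝ v) (x : E2) (s : ℝ) (i : Fin 2) (y : E2) :
    pder (fun y => v (x + s • y)) i y = s • pder v i (x + s • y) := by
  have h1 : HasFDerivAt (fun y : E2 => x + s • y) (s • ContinuousLinearMap.id ℝ E2) y :=
    ((hasFDerivAt_id y).const_smul s).const_add x
  have h2 := (hv (x + s • y)).hasFDerivAt.comp y h1
  have h3 : fderiv ℝ (fun y => v (x + s • y)) y =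
    (fderiv ℝ v (x + s • y)).comp (s • ContinuousLinearMap.id ℝ E2) := h2.fderiv
  simp [pder, h3]

lemma lap_comp_add_smul (hv : ContDiff ℝ (⊤ : ℕ∞) v) (x : E2) (s : ℝ) (y : E2) :
    lap (fun y => v (x + s • y)) y = s ^ 2 • lap v (x + s • y) := by
  unfold lap
  rw [Finset.smul_sum]
  refine Finset.sum_congr rfl fun i _ => ?_
  have h1 : pder (fun y => v (x + s • y)) i = s • fun y => pder v i (x + s • y) :=
    funext fun y => pder_comp_add_smul (hv.differentiable (by simp)) x s i y
  have hd : Differentiable ℝ (pder v i) := (contDiff_pder hv i).differentiable (by simp)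
  have hd' : Differentiable ℝ fun y => pder v i (x + s • y) := hd.comp (by fun_prop)
  have h2 := pder_comp_add_smul hd x s i y
  rw [h1, fderiv_const_smul (hd' y), pow_two, mul_smul]
  exact congrArg (s • ·) h2

lemma eDens_comp_add_smul (hv : Differentiable ℝ v) (hs : 0 < s) (x y : E2) :
    eDens V (ε / s) (fun y => v (x + s • y)) y = s * eDens V ε v (x + s • y) := by
  have h : gradSq (fun y => v (x + s • y)) y = s ^ 2 * gradSq v (x + s • y) := by
    simp only [gradSq, pder_comp_add_smul hv, norm_smul, mul_pow, Real.norm_eq_abs, sq_abs,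
      Finset.mul_sum]
  unfold eDens
  rw [h, inv_div]
  field_simp

lemma setIntegral_ball_comp_add_smul (f : E2 → ℝ) (hs : 0 < s) (x : E2) (r : ℝ) :
    ∫ y in ball (0 : E2) r, f (x + s • y) = (s ^ 2)⁻¹ * ∫ y in ball x (s * r), f y := by
  rw [← integral_indicator measurableSet_ball, ← integral_indicator measurableSet_ball]
  have h1 : ∀ y, (ball (0 : E2) r).indicator (fun y => f (x + s • y)) y =
      (ball x (s * r)).indicator f (x + s • y) := by
    intro y
    have : x + s • y ∈ ball x (s * r) ↔ y ∈ ball (0 : E2) r := by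
      rw [mem_ball, mem_ball_zero_iff, dist_eq_norm, add_sub_cancel_left, norm_smul,
        Real.norm_of_nonneg hs.le, mul_lt_mul_iff_right₀ hs]
    by_cases h : y ∈ ball (0 : E2) r
    · rw [Set.indicator_of_mem h, Set.indicator_of_mem (this.2 h)]
    · rw [Set.indicator_of_notMem h, Set.indicator_of_notMem fun h' => h (this.1 h')]
  simp_rw [h1]
  rw [Measure.integral_comp_smul volume fun y => (ball x (s * r)).indicator f (x + y),
    integral_add_left_eq_self]
  simp [abs_of_pos hs]

lemma exists_contDiff_eventuallyEq {Ω : Set E2} (hΩ : IsOpen Ω)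
    (hu : ContDiffOn ℝ (⊤ : ℕ∞) u Ω) {r R : ℝ} (hr : 0 < r) (hrR : r < R)
    (hR : closedBall x R ⊆ Ω) :
    ∃ v : E2 → Evec k, ContDiff ℝ (⊤ : ℕ∞) v ∧ ∀ y ∈ ball x r, v =ᶠ[𝓝 y] u := by
  let f : ContDiffBump x := ⟨r, R, hr, hrR⟩
  refine ⟨fun y => f y • u y, contDiff_iff_contDiffAt.2 fun y => ?_, fun y hy => ?_⟩
  · by_cases hy : y ∈ Ω
    · exact f.contDiff.contDiffAt.smul (hu.contDiffAt (hΩ.mem_nhds hy))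
    · have h1 : y ∉ tsupport f := fun h => hy (hR (by rwa [f.tsupport_eq] at h))
      refine (contDiffAt_const (c := (0 : Evec k))).congr_of_eventuallyEq ?_
      filter_upwards [(isClosed_tsupport f).isOpen_compl.mem_nhds h1] with w hw
      rw [image_eq_zero_of_notMem_tsupport hw, zero_smul]
  · filter_upwards [isOpen_ball.mem_nhds hy] with w hw
    rw [f.one_of_mem_closedBall (ball_subset_closedBall hw), one_smul]

lemma pder_eventuallyEq {y : E2} (h : v =ᶠ[𝓝 y] u) (i : Fin 2) : pder v i =ᶠ[𝓝 y] pder u i := by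
  filter_upwards [h.fderiv (𝕜 := ℝ)] with w hw
  simp [pder, hw]

lemma lap_eq_of_eventuallyEq {y : E2} (h : v =ᶠ[𝓝 y] u) : lap v y = lap u y := by
  unfold lap
  exact Finset.sum_congr rfl fun i _ => by rw [(pder_eventuallyEq h i).fderiv_eq]

lemma eDens_eq_of_eventuallyEq {y : E2} (h : v =ᶠ[𝓝 y] u) (V : Evec k → ℝ) (ε : ℝ) :
    eDens V ε v y = eDens V ε u y := by
  unfold eDens gradSq
  simp only [(pder_eventuallyEq h _).eq_of_nhds, h.eq_of_nhds]

/-- The energy decay on disks of arbitrary radius. -/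
lemma IsMultiWell.exists_energy_decay_of_isSolution (hV : IsMultiWell V) {c : ℝ} (hc : 0 < c) :
    ∃ η > (0 : ℝ), ∃ ε₀ > (0 : ℝ), ∀ ε > (0 : ℝ), ∀ s > (0 : ℝ), ε ≤ ε₀ * s →
      ∀ (Ω : Set E2), IsOpen Ω → ∀ u : E2 → Evec k, IsSolution V ε Ω u →
      ∀ x, closedBall x (4 * s) ⊆ Ω →
      ∫ y in ball x (3 * s), eDens V ε u y ≤ η * s →
        ∫ y in ball x (s / 4), eDens V ε u y ≤ c * ∫ y in ball x (3 * s), eDens V ε u y := by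
  obtain ⟨η, hη, ε₀, hε₀, hdecay⟩ := hV.exists_energy_decay hc
  refine ⟨η, hη, ε₀, hε₀, fun ε hε s hs hεs Ω hΩ u hu x hx hE => ?_⟩
  obtain ⟨v, hv, hvu⟩ := exists_contDiff_eventuallyEq hΩ hu.1 (by positivity : 0 < 3 * s)
    (by linarith : 3 * s < 4 * s) hx
  have hvd : Differentiable ℝ v := hv.differentiable (by simp)
  have hInt : ∀ r ≤ 3, ∫ y in ball (0 : E2) r, eDens V (ε / s) (fun y => v (x + s • y)) y =
      s⁻¹ * ∫ y in ball x (s * r), eDens V ε u y := by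
    intro r hr
    simp_rw [eDens_comp_add_smul hvd hs]
    rw [integral_const_mul, setIntegral_ball_comp_add_smul (eDens V ε v) hs]
    rw [setIntegral_congr_fun measurableSet_ball fun y hy => eDens_eq_of_eventuallyEq
      (hvu y (ball_subset_ball (by nlinarith) hy)) V ε]
    field_simp
  have h := hdecay (ε / s) (by positivity) (by rwa [div_le_iff₀ hs]) (fun y => v (x + s • y))
    (hv.comp (by fun_prop)) ?_ ?_
  · rw [hInt _ (by norm_num), hInt _ le_rfl] at h
    have h2 := mul_le_mul_of_nonneg_left h hs.le
    rw [mul_left_comm c, mul_inv_cancel_left₀ hs.ne', mul_inv_cancel_left₀ hs.ne'] at h2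
    rwa [mul_comm 3 s, div_eq_mul_one_div]
  · intro y hy
    have hmem : x + s • y ∈ ball x (3 * s) := by
      rw [mem_ball_zero_iff] at hy
      rw [mem_ball, dist_eq_norm, add_sub_cancel_left, norm_smul, Real.norm_of_nonneg hs.le]
      nlinarith
    have hmemΩ : x + s • y ∈ Ω :=
      hx (ball_subset_closedBall (ball_subset_ball (by linarith) hmem))
    rw [lap_comp_add_smul hv, lap_eq_of_eventuallyEq (hvu _ hmem), hu.2 _ hmemΩ,
      (hvu _ hmem).eq_of_nhds, smul_smul, div_pow, inv_div]
    congr 1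
  · rw [hInt _ le_rfl, mul_comm s 3, inv_mul_le_iff₀ hs, mul_comm s]
    exact hE

end Transfer

section LimitMeasure

lemma exists_testFun {Ω : Set E2} {x : E2} {r R : ℝ} (hr : 0 < r) (hrR : r < R)
    (hR : closedBall x R ⊆ Ω) :
    ∃ f : E2 → ℝ, TestFun Ω f ∧ (∀ y, 0 ≤ f y) ∧ (∀ y, f y ≤ 1) ∧ (∀ y ∈ closedBall x r, f y = 1) ∧
      ∀ y ∉ ball x R, f y = 0 := by
  let f : ContDiffBump x := ⟨r, R, hr, hrR⟩
  have hs : Function.support f = ball x R := f.support_eq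
  refine ⟨f, ⟨f.continuous, f.hasCompactSupport, by rwa [f.tsupport_eq]⟩, fun y => f.nonneg,
    fun y => f.le_one, fun y hy => f.one_of_mem_closedBall hy, fun y hy => ?_⟩
  by_contra h
  exact hy (hs ▸ Function.mem_support.2 h)

variable {k : ℕ} {V : Evec k → ℝ}

/-- The energy decay passes to the limit measure. -/
lemma IsMultiWell.exists_measure_decay (hV : IsMultiWell V) {c : ℝ} (hc : 0 < c) :
    ∃ η > (0 : ℝ), ∀ (Ω : Set E2), IsOpen Ω → ∀ (ε : ℕ → ℝ) (u : ℕ → E2 → Evec k),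
      (∀ n, 0 < ε n) → Tendsto ε atTop (𝓝 0) → (∀ n, IsSolution V (ε n) Ω (u n)) →
      (∀ n, IntegrableOn (eDens V (ε n) (u n)) Ω) →
      ∀ ν : Measure E2, IsFiniteMeasure ν →
        (∀ f : E2 → ℝ, TestFun Ω f →
          Tendsto (fun n => ∫ x in Ω, f x * eDens V (ε n) (u n) x) atTop
            (𝓝 (∫ x, f x ∂ν))) →
        ∀ x, ∀ s > (0 : ℝ), closedBall x (4 * s) ⊆ Ω → ν.real (closedBall x (4 * s)) < η * s →
          ν.real (closedBall x (s / 8)) ≤ c * ν.real (closedBall x (4 * s)) := by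
  obtain ⟨η, hη, ε₀, hε₀, hdecay⟩ := hV.exists_energy_decay_of_isSolution hc
  refine ⟨η, hη, fun Ω hΩ ε u hε hεlim hu hInt ν hν hlim x s hs hx hνx => ?_⟩
  have hV0 := hV.nonneg
  obtain ⟨f, hf, hf0, hf1, hfin, hfout⟩ := exists_testFun (Ω := Ω) (x := x) (r := s / 8)
    (R := s / 4) (by positivity) (by linarith)
    ((closedBall_subset_closedBall (by linarith)).trans hx)
  obtain ⟨g, hg, hg0, hg1, hgin, hgout⟩ := exists_testFun (Ω := Ω) (x := x) (r := 3 * s)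
    (R := 4 * s) (by positivity) (by linarith) hx
  have hsub : ∀ r ≤ 4, ball x (r * s) ⊆ Ω := fun r hr =>
    (ball_subset_closedBall.trans (closedBall_subset_closedBall (by nlinarith))).trans hx
  have hmulint : ∀ h : E2 → ℝ, TestFun Ω h → ∀ n,
      IntegrableOn (fun y => h y * eDens V (ε n) (u n) y) Ω := by
    intro h hh n
    obtain ⟨C, hC⟩ := hh.1.bounded_above_of_compact_support hh.2.1
    exact (hInt n).bdd_mul hh.1.aestronglyMeasurable (Filter.Eventually.of_forall hC)
  have hfint : Integrable f ν := hf.1.integrable_of_hasCompactSupport hf.2.1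
  have hgint : Integrable g ν := hg.1.integrable_of_hasCompactSupport hg.2.1
  have hgν : ∫ y, g y ∂ν ≤ ν.real (closedBall x (4 * s)) := by
    rw [← integral_indicator_one measurableSet_closedBall]
    refine integral_mono hgint ((integrable_const (1 : ℝ)).indicator measurableSet_closedBall)
      fun y => ?_
    by_cases hy : y ∈ closedBall x (4 * s)
    · simpa [hy] using hg1 y
    · simp [hy, hgout y fun h => hy (ball_subset_closedBall h)]
  have hfν : ν.real (closedBall x (s / 8)) ≤ ∫ y, f y ∂ν := by
    rw [← integral_indicator_one measurableSet_closedBall]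
    refine integral_mono ((integrable_const (1 : ℝ)).indicator measurableSet_closedBall) hfint
      fun y => ?_
    by_cases hy : y ∈ closedBall x (s / 8)
    · simp [hy, hfin y hy]
    · simpa [hy] using hf0 y
  have hev1 := (hlim g hg).eventually (gt_mem_nhds (hgν.trans_lt hνx))
  have hev2 := hεlim.eventually (gt_mem_nhds (by positivity : 0 < ε₀ * s))
  have hle : ∫ y, f y ∂ν ≤ c * ∫ y, g y ∂ν := by
    refine le_of_tendsto_of_tendsto (hlim f hf) ((hlim g hg).const_mul c) ?_
    filter_upwards [hev1, hev2] with n hn1 hn2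
    have he := eDens_nonneg hV0 (hε n) (u n)
    have hgE : ∫ y in ball x (3 * s), eDens V (ε n) (u n) y ≤
        ∫ y in Ω, g y * eDens V (ε n) (u n) y := by
      refine le_trans (le_of_eq ?_) (setIntegral_mono_set (hmulint g hg n)
        (Filter.Eventually.of_forall fun y => mul_nonneg (hg0 y) (he y))
        (hsub 3 (by norm_num)).eventuallyLE)
      refine setIntegral_congr_fun measurableSet_ball fun y hy => ?_
      simp [hgin y (ball_subset_closedBall hy)]
    have hfE : ∫ y in Ω, f y * eDens V (ε n) (u n) y ≤
        ∫ y in ball x (s / 4), eDens V (ε n) (u n) y := by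
      have hsub4 : ball x (s / 4) ⊆ Ω := by
        have := hsub (1 / 4) (by norm_num)
        rwa [one_div_mul_eq_div] at this
      rw [setIntegral_eq_of_subset_of_forall_sdiff_eq_zero hΩ.measurableSet hsub4
        fun y hy => by rw [hfout y hy.2, zero_mul]]
      exact setIntegral_mono ((hmulint f hf n).mono_set hsub4) ((hInt n).mono_set hsub4)
        fun y => mul_le_of_le_one_left (he y) (hf1 y)
    have hd := hdecay (ε n) (hε n) s hs hn2.le Ω hΩ (u n) (hu n) x hx (hgE.trans hn1.le)
    calc _ ≤ _ := hfE
      _ ≤ _ := hd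
      _ ≤ _ := by gcongr
  calc _ ≤ _ := hfν
    _ ≤ _ := hle
    _ ≤ _ := by gcongr

lemma measureReal_closedBall_iterate {ν : Measure E2} {x : E2} {R η : ℝ} (hR : 0 < R)
    (hdecay : ∀ s > (0 : ℝ), s ≤ R / 4 → ν.real (closedBall x (4 * s)) < η * s →
      ν.real (closedBall x (s / 8)) ≤ 1 / 2048 * ν.real (closedBall x (4 * s)))
    (hx : ν.real (closedBall x R) < η * (R / 4)) (j : ℕ) :
    ν.real (closedBall x (R / 32 ^ j)) ≤ (1 / 2048) ^ j * ν.real (closedBall x R) := by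
  induction j with
  | zero => simp
  | succ j ih =>
    have h4 : 4 * (R / 32 ^ j / 4) = R / 32 ^ j := by ring
    have h8 : R / 32 ^ j / 4 / 8 = R / 32 ^ (j + 1) := by rw [pow_succ]; ring
    have h := hdecay (R / 32 ^ j / 4) (by positivity) (by
      gcongr
      exact div_le_self hR.le (one_le_pow₀ (by norm_num))) ?_
    · rw [h4, h8] at h
      calc _ ≤ _ := h
        _ ≤ 1 / 2048 * ((1 / 2048) ^ j * ν.real (closedBall x R)) := by gcongr
        _ = _ := by ring
    · rw [h4]
      refine ih.trans_lt ?_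
      calc (1 / 2048) ^ j * ν.real (closedBall x R) ≤ (1 / 32) ^ j * ν.real (closedBall x R) := by
            gcongr; norm_num
        _ < (1 / 32) ^ j * (η * (R / 4)) := by gcongr
        _ = η * (R / 32 ^ j / 4) := by rw [one_div, inv_pow]; ring

/-- A measure decaying faster than the area on a geometric sequence of disks around every point of
a set does not charge that set. -/
lemma measure_eq_zero_of_decay {ν : Measure E2} [IsFiniteMeasure ν] {S : Set E2} {R M : ℝ}
    (hR : 0 < R)
    (hS : ∀ x ∈ S, ∀ j : ℕ, ν.real (closedBall x (R / 32 ^ j)) ≤ (1 / 2048) ^ j * M) :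
    ν S = 0 := by
  have h1 := Besicovitch.ae_tendsto_rnDeriv (volume : Measure E2) ν
  have h2 := Measure.rnDeriv_lt_top (volume : Measure E2) ν
  refine measure_mono_null (fun x hx => ?_) (ae_iff.1 (h1.and h2))
  rintro ⟨hlim, htop⟩
  have hRj : Tendsto (fun j : ℕ => R / 32 ^ j) atTop (𝓝[>] 0) := by
    refine tendsto_nhdsWithin_iff.2 ⟨?_, Filter.Eventually.of_forall fun j => by
      simp only [Set.mem_Ioi]; positivity⟩
    have := (tendsto_pow_atTop_nhds_zero_of_lt_one (r := (1 / 32 : ℝ)) (by norm_num)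
      (by norm_num)).const_mul R
    simpa [div_eq_mul_inv] using this
  obtain ⟨T, hT1, hT2⟩ := ENNReal.lt_iff_exists_nnreal_btwn.1 htop
  have hev := (hlim.comp hRj).eventually (gt_mem_nhds hT1)
  have hbd : ∀ᶠ j : ℕ in atTop, volume.real (closedBall (0 : E2) 1) * R ^ 2 * 2 ^ j ≤ T * M := by
    filter_upwards [hev] with j hj
    have h3 := (ENNReal.div_le_iff_le_mul (Or.inr ENNReal.coe_ne_top)
      (Or.inl (measure_ne_top ν _))).1 hj.le
    have h4 := ENNReal.toReal_mono (ENNReal.mul_ne_top ENNReal.coe_ne_top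
      (measure_ne_top ν _)) h3
    rw [ENNReal.toReal_mul, ENNReal.coe_toReal] at h4
    change volume.real _ ≤ T * ν.real _ at h4
    have h5 : volume.real (closedBall x (R / 32 ^ j)) =
        (R / 32 ^ j) ^ 2 * volume.real (closedBall (0 : E2) 1) := by
      rw [Measure.addHaar_real_closedBall' _ _ (by positivity)]
      simp
    rw [h5] at h4
    have h6 : (T : ℝ) * ν.real (closedBall x (R / 32 ^ j)) ≤ T * ((1 / 2048) ^ j * M) := by
      gcongr
      exact hS x hx j
    have h7 := mul_le_mul_of_nonneg_left (h4.trans h6) (by positivity : (0 : ℝ) ≤ 2048 ^ j)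
    have h8 : (2048 : ℝ) ^ j = 2 ^ j * (32 ^ j) ^ 2 := by
      rw [← pow_mul, mul_comm j 2, pow_mul, ← mul_pow]; norm_num
    calc _ = 2048 ^ j * ((R / 32 ^ j) ^ 2 * volume.real (closedBall (0 : E2) 1)) := by
          rw [h8]; field_simp
      _ ≤ _ := h7
      _ = T * M := by rw [one_div, inv_pow]; field_simp
  have hvol : 0 < volume.real (closedBall (0 : E2) 1) :=
    ENNReal.toReal_pos (measure_closedBall_pos volume 0 one_pos).ne'
      (isCompact_closedBall 0 1).measure_lt_top.ne
  have hgrow : Tendsto (fun j : ℕ => volume.real (closedBall (0 : E2) 1) * R ^ 2 * 2 ^ j)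
      atTop atTop :=
    (tendsto_pow_atTop_atTop_of_one_lt (by norm_num)).const_mul_atTop (by positivity)
  obtain ⟨j, hj1, hj2⟩ := (hbd.and (hgrow.eventually_gt_atTop (T * M))).exists
  linarith

end LimitMeasure

/-- clearing-out for the limiting energy measure. There is a
constant `η₁ > 0` depending only on `V` such that whenever `ν` is the weak-*
limit of the energy measures of a bounded-energy family of solutions, for any
disk `D(x₀,r) ⊆ Ω`: if `ν(D̄(x₀,r)) < η₁·r` then `ν(D̄(x₀,r/2)) = 0`. -/
theorem statement_6 (k : ℕ) (hk : 1 ≤ k) (V : Evec k → ℝ) (hV : IsMultiWell V) :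
    ∃ η₁ > (0 : ℝ),
      ∀ (Ω : Set E2), IsOpen Ω → IsBounded Ω →
      ∀ (M₀ : ℝ), 0 < M₀ →
      ∀ (ε : ℕ → ℝ) (u : ℕ → E2 → Evec k),
        (∀ n, 0 < ε n) →
        Tendsto ε atTop (𝓝 0) →
        (∀ n, IsSolution V (ε n) Ω (u n)) →
        (∀ n, IntegrableOn (eDens V (ε n) (u n)) Ω) →
        (∀ n, energy V (ε n) (u n) Ω ≤ M₀) →
      ∀ ν : Measure E2, IsFiniteMeasure ν → ν Ωᶜ = 0 →
        (∀ f : E2 → ℝ, TestFun Ω f →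
          Tendsto (fun n => ∫ x in Ω, f x * eDens V (ε n) (u n) x) atTop
            (𝓝 (∫ x, f x ∂ν))) →
        ∀ x₀ ∈ Ω, ∀ r : ℝ, 0 < r → ball x₀ r ⊆ Ω →
          (ν (closedBall x₀ r)).toReal < η₁ * r →
            ν (closedBall x₀ (r / 2)) = 0 := by
  obtain ⟨η, hη, hdecay⟩ := hV.exists_measure_decay (c := 1 / 2048) (by norm_num)
  refine ⟨η / 16, by positivity, ?_⟩
  intro Ω hΩ _ M₀ _ ε u hε hεlim hu hInt _ ν hν _ hlim x₀ _ r hr hball hνr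
  have hsub : ∀ x ∈ closedBall x₀ (r / 2), closedBall x (r / 4) ⊆ ball x₀ r := fun x hx y hy => by
    rw [mem_closedBall] at hx hy
    rw [mem_ball]
    linarith [dist_triangle y x x₀]
  refine measure_eq_zero_of_decay (R := r / 4) (M := ν.real (closedBall x₀ r)) (by positivity)
    fun x hx j => ?_
  have hle : ν.real (closedBall x (r / 4)) ≤ ν.real (closedBall x₀ r) :=
    measureReal_mono ((hsub x hx).trans ball_subset_closedBall)
  refine (measureReal_closedBall_iterate (η := η) (by positivity) (fun s hs hsr h => ?_)
    (hle.trans_lt ?_) j).trans (by gcongr)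
  · refine hdecay Ω hΩ ε u hε hεlim hu hInt ν hν hlim x s hs ?_ h
    exact (closedBall_subset_closedBall (by linarith)).trans ((hsub x hx).trans hball)
  · change (ν (closedBall x₀ r)).toReal < _
    linarith
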